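/- arXiv:math/0601536 — 7 statements merged into one kernel-verified Lean document; each statement's English description precedes it below -/
import Mathlib

section
/- Let K be a field of characteristic 2 in which every element has a square root, and let B and C be n×n matrices over K. Then there exists an invertible n×n matrix M over K such that M B Mᵀ − C is symmetric if and only if rank(B + Bᵀ) = rank(C + Cᵀ). -/
open Matrix

/-- A hyperbolic pair `x, y` of an alternating form splits off a hyperbolic plane, with complement
the common orthogonal of `x` and `y`. -/
theorem LinearMap.BilinForm.IsAlt.exists_equiv_prod_of_eq_one {K V : Type*} [Field K]
    [AddCommGroup V] [Module K V] {ω : LinearMap.BilinForm K V} (hω : ω.IsAlt) {x y : V}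
    (hxy : ω x y = 1) :
    ∃ e : (K × K × ↥(LinearMap.ker (ω x) ⊓ LinearMap.ker (ω y))) ≃ₗ[K] V,
      ∀ p q, ω (e p) (e q) = p.1 * q.2.1 - p.2.1 * q.1 + ω p.2.2 q.2.2 := by
  have hyx : ω y x = -1 := by rw [← hω.neg_eq, hxy]
  have hflip (u v : V) : ω u v = -ω v u := (hω.neg_eq v u).symm
  let f : (K × K × ↥(LinearMap.ker (ω x) ⊓ LinearMap.ker (ω y))) →ₗ[K] V :=
    (LinearMap.toSpanSingleton K V x).coprod
      ((LinearMap.toSpanSingleton K V y).coprod (Submodule.subtype _))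
  have hf (p) : f p = p.1 • x + (p.2.1 • y + p.2.2) := by simp [f]
  have hbij : Function.Bijective f := by
    constructor
    · rw [← LinearMap.ker_eq_bot, LinearMap.ker_eq_bot']
      rintro ⟨a, b, v, hvx, hvy⟩ h
      rw [hf] at h
      simp only [LinearMap.mem_ker, SetLike.mem_coe] at hvx hvy
      have hb : b = 0 := by
        simpa [hxy, hvx, hω.self_eq_zero] using congrArg (ω x) h
      have ha : a = 0 := by
        simpa [hyx, hvy, hω.self_eq_zero] using congrArg (ω y) h
      subst ha hb
      have hv : v = 0 := by simpa using h
      subst hv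
      rfl
    · intro v
      refine ⟨(-ω y v, ω x v, ⟨v + ω y v • x - ω x v • y, ?_, ?_⟩), ?_⟩
      · simp [hxy, hω.self_eq_zero]
      · simp [hyx, hω.self_eq_zero]
      · rw [hf]
        module
  refine ⟨LinearEquiv.ofBijective f hbij, ?_⟩
  rintro ⟨a, b, v, hvx, hvy⟩ ⟨c, d, w, hwx, hwy⟩
  simp only [LinearMap.mem_ker, SetLike.mem_coe] at hvx hvy hwx hwy
  simp only [LinearEquiv.ofBijective_apply, hf]
  simp only [map_add, map_smul, LinearMap.add_apply, LinearMap.smul_apply, smul_eq_mul, hxy, hyx,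
    hω.self_eq_zero, hwx, hwy, hflip v x, hflip v y, hvx, hvy]
  ring

/-- The radical of an alternating form agrees with that of its restriction to the orthogonal of
a hyperbolic pair. -/
theorem LinearMap.BilinForm.IsAlt.finrank_ker_restrict_of_eq_one {K V : Type*} [Field K]
    [AddCommGroup V] [Module K V] {ω : LinearMap.BilinForm K V} (hω : ω.IsAlt) {x y : V}
    (hxy : ω x y = 1) :
    Module.finrank K
        (LinearMap.ker (ω.restrict (LinearMap.ker (ω x) ⊓ LinearMap.ker (ω y)))) =
      Module.finrank K (LinearMap.ker ω) := by
  have hflip (u v : V) : ω u v = -ω v u := (hω.neg_eq v u).symm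
  have hle : LinearMap.ker ω ≤ LinearMap.ker (ω x) ⊓ LinearMap.ker (ω y) := by
    intro v hv
    rw [LinearMap.mem_ker] at hv
    simp [hflip _ v, hv]
  have hker : LinearMap.ker (ω.restrict (LinearMap.ker (ω x) ⊓ LinearMap.ker (ω y))) =
      (LinearMap.ker ω).comap (Submodule.subtype _) := by
    ext v
    simp only [LinearMap.mem_ker, Submodule.mem_comap, Submodule.subtype_apply]
    constructor
    · intro hv
      have hvx : ω x v = 0 := v.2.1
      have hvy : ω y v = 0 := v.2.2
      ext u
      have hyx : ω y x = -1 := by rw [← hω.neg_eq, hxy]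
      have hu : u + ω y u • x - ω x u • y ∈ LinearMap.ker (ω x) ⊓ LinearMap.ker (ω y) := by
        constructor <;> simp [hxy, hyx, hω.self_eq_zero]
      have := LinearMap.congr_fun hv ⟨_, hu⟩
      simpa [hflip v x, hflip v y, hvx, hvy] using this
    · intro hv
      ext u
      simp [hv]
  rw [hker]
  exact (Submodule.comapSubtypeEquivOfLe hle).finrank_eq

/-- A nonzero bilinear form over a field takes the value `1`. -/
theorem LinearMap.BilinForm.exists_eq_one_of_ne_zero {K V : Type*} [Field K] [AddCommGroup V]
    [Module K V] {ω : LinearMap.BilinForm K V} (hω : ω ≠ 0) : ∃ x y, ω x y = 1 := by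
  obtain ⟨x, y, hxy⟩ : ∃ x y, ω x y ≠ 0 := by
    by_contra! hzero
    exact hω (LinearMap.ext₂ hzero)
  exact ⟨x, (ω x y)⁻¹ • y, by simp [hxy]⟩

/-- Alternating forms on spaces of the same finite dimension are isometric if their radicals have
the same dimension. -/
theorem LinearMap.BilinForm.IsAlt.exists_isometry {K V W : Type*} [Field K]
    [AddCommGroup V] [Module K V] [FiniteDimensional K V]
    [AddCommGroup W] [Module K W] [FiniteDimensional K W]
    {ω : LinearMap.BilinForm K V} {η : LinearMap.BilinForm K W} (hω : ω.IsAlt) (hη : η.IsAlt)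
    (hdim : Module.finrank K V = Module.finrank K W)
    (hker : Module.finrank K (LinearMap.ker ω) = Module.finrank K (LinearMap.ker η)) :
    ∃ e : V ≃ₗ[K] W, ∀ u v, η (e u) (e v) = ω u v := by
  induction h : Module.finrank K V using Nat.strong_induction_on generalizing V W with
  | _ n ih =>
  by_cases hω0 : ω = 0
  · have hη0 : η = 0 := by
      rw [← LinearMap.ker_eq_top]
      apply Submodule.eq_top_of_finrank_eq
      rw [← hker, ← hdim, hω0, LinearMap.ker_zero, finrank_top]
    exact ⟨LinearEquiv.ofFinrankEq V W hdim, by simp [hω0, hη0]⟩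
  have hη0 : η ≠ 0 := by
    intro hη0
    apply hω0
    rw [← LinearMap.ker_eq_top]
    apply Submodule.eq_top_of_finrank_eq
    rw [hker, hdim, hη0, LinearMap.ker_zero, finrank_top]
  obtain ⟨x, y, hxy⟩ := LinearMap.BilinForm.exists_eq_one_of_ne_zero hω0
  obtain ⟨z, w, hzw⟩ := LinearMap.BilinForm.exists_eq_one_of_ne_zero hη0
  obtain ⟨e₁, he₁⟩ := hω.exists_equiv_prod_of_eq_one hxy
  obtain ⟨e₂, he₂⟩ := hη.exists_equiv_prod_of_eq_one hzw
  have d₁ := e₁.finrank_eq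
  have d₂ := e₂.finrank_eq
  simp only [Module.finrank_prod, Module.finrank_self] at d₁ d₂
  obtain ⟨e, he⟩ := ih _ (by omega)
    (ω := ω.restrict (LinearMap.ker (ω x) ⊓ LinearMap.ker (ω y)))
    (η := η.restrict (LinearMap.ker (η z) ⊓ LinearMap.ker (η w)))
    (fun v => hω.self_eq_zero v) (fun v => hη.self_eq_zero v) (by omega)
    (by rw [hω.finrank_ker_restrict_of_eq_one hxy, hη.finrank_ker_restrict_of_eq_one hzw, hker])
    rfl
  simp only [LinearMap.BilinForm.restrict_apply, LinearMap.domRestrict_apply] at he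
  refine ⟨e₁.symm ≪≫ₗ ((LinearEquiv.refl K K).prodCongr
    ((LinearEquiv.refl K K).prodCongr e)) ≪≫ₗ e₂, fun u v => ?_⟩
  obtain ⟨p, rfl⟩ := e₁.surjective u
  obtain ⟨q, rfl⟩ := e₁.surjective v
  simp [he₁, he₂, he]

/-- Alternating matrices of the same rank are congruent. -/
theorem Matrix.exists_mul_mul_transpose_eq_of_isAlt_of_rank_eq {K ι : Type*} [Field K] [Fintype ι]
    [DecidableEq ι] {A D : Matrix ι ι K} (hA : (toBilin' A).IsAlt) (hD : (toBilin' D).IsAlt)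
    (hrank : A.rank = D.rank) : ∃ M : Matrix ι ι K, IsUnit M.det ∧ M * A * Mᵀ = D := by
  have finrank_ker (N : Matrix ι ι K) :
      N.rank + Module.finrank K (LinearMap.ker (toBilin' N)) = Fintype.card ι := by
    have hker : LinearMap.ker (toBilin' N) = LinearMap.ker Nᵀ.mulVecLin := by
      ext v
      simp only [LinearMap.mem_ker, mulVecLin_apply, mulVec_transpose]
      rw [← dotProduct_eq_zero_iff, LinearMap.ext_iff]
      simp [toBilin'_apply', dotProduct_mulVec]
    rw [hker, ← rank_transpose, Matrix.rank, LinearMap.finrank_range_add_finrank_ker,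
      Module.finrank_fintype_fun_eq_card]
  obtain ⟨e, he⟩ := hD.exists_isometry hA rfl (by
    have := finrank_ker A
    have := finrank_ker D
    omega)
  refine ⟨(LinearMap.toMatrix' (e : (ι → K) →ₗ[K] (ι → K)))ᵀ, ?_, ?_⟩
  · rw [det_transpose, LinearMap.det_toMatrix']
    exact e.isUnit_det'
  · apply toBilin'.injective
    rw [transpose_transpose, ← toBilin'_comp]
    ext u v
    simp [he]

/-- In characteristic two, `A + Aᵀ` is alternating. -/
theorem Matrix.isAlt_toBilin'_add_transpose {K ι : Type*} [Field K] [CharP K 2] [Fintype ι]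
    [DecidableEq ι] (A : Matrix ι ι K) : (toBilin' (A + Aᵀ)).IsAlt := by
  intro v
  rw [toBilin'_apply', add_mulVec, dotProduct_add, mulVec_transpose, dotProduct_mulVec,
    dotProduct_comm v, CharTwo.add_self_eq_zero]

/-- Classification of bilinear forms modulo symmetric forms, over a field of characteristic 2 in
which every element has a square root: the classes of `B` and `C` are equivalent (that is,
`M * B * Mᵀ − C` is symmetric for some invertible `M`) if and only if
`rank (B + Bᵀ) = rank (C + Cᵀ)`. -/
theorem class_mod_symmetric_equiv_iff_rank_eq
    (K : Type*) [Field K] [CharP K 2] (hsqrt : ∀ a : K, ∃ b : K, b * b = a)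
    (n : ℕ) (B C : Matrix (Fin n) (Fin n) K) :
    (∃ M : Matrix (Fin n) (Fin n) K, IsUnit M.det ∧ (M * B * Mᵀ - C).IsSymm) ↔
      (B + Bᵀ).rank = (C + Cᵀ).rank := by
  have isSymm_iff (M : Matrix (Fin n) (Fin n) K) :
      (M * B * Mᵀ - C).IsSymm ↔ M * (B + Bᵀ) * Mᵀ = C + Cᵀ := by
    have htranspose : (M * B * Mᵀ - C)ᵀ = M * Bᵀ * Mᵀ - Cᵀ := by
      simp [Matrix.mul_assoc]
    rw [Matrix.IsSymm, htranspose, Matrix.mul_add, Matrix.add_mul, ← Matrix.ext_iff,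
      ← Matrix.ext_iff]
    refine forall₂_congr fun i j => ?_
    simp only [Matrix.sub_apply, Matrix.add_apply, CharTwo.sub_eq_add]
    have h2 : (2 : K) = 0 := CharTwo.two_eq_zero
    constructor <;> intro h <;> grind
  simp only [isSymm_iff]
  constructor
  · rintro ⟨M, hM, h⟩
    rw [← h, rank_mul_eq_left_of_isUnit_det _ _ (by rwa [det_transpose]),
      rank_mul_eq_right_of_isUnit_det _ _ hM]
  · exact exists_mul_mul_transpose_eq_of_isAlt_of_rank_eq (isAlt_toBilin'_add_transpose B)
      (isAlt_toBilin'_add_transpose C)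
end

section
/- Let K be a field of characteristic 2 and n > 2. Then the derived algebra o_I^(1)(n) = [o_I(n), o_I(n)] equals ZD(n), the space of symmetric zero-diagonal n×n matrices over K, and o_I^(2)(n) = o_I^(1)(n). -/
open Matrix

/-- The derived space `[p, p]`: the span of all commutators of elements of `p`. -/
def commSpan (K : Type*) [Field K] {m : Type*} [Fintype m]
    (p : Submodule K (Matrix m m K)) : Submodule K (Matrix m m K) :=
  Submodule.span K {z | ∃ x ∈ p, ∃ y ∈ p, z = x * y - y * x}

/-- The space of symmetric matrices; over a field of characteristic 2 this is the Lie algebra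
`o_I(n) = {X : X·1ₙ + 1ₙ·Xᵀ = 0}`. -/
def symmSubmodule (K : Type*) [Field K] (m : Type*) : Submodule K (Matrix m m K) where
  carrier := {X | X.IsSymm}
  add_mem' := fun ha hb => ha.add hb
  zero_mem' := isSymm_zero
  smul_mem' := fun c _ ha => ha.smul c

/-- The space `ZD` of symmetric matrices with zero diagonal. -/
def zeroDiagSymm (K : Type*) [Field K] (m : Type*) : Submodule K (Matrix m m K) where
  carrier := {X | X.IsSymm ∧ ∀ i, X i i = 0}
  add_mem' := fun ha hb => ⟨ha.1.add hb.1, fun i => by simp [ha.2 i, hb.2 i]⟩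
  zero_mem' := ⟨isSymm_zero, fun _ => rfl⟩
  smul_mem' := fun c _ ha => ⟨ha.1.smul c, fun i => by simp [ha.2 i]⟩

theorem commSpan_mono {K : Type*} [Field K] {m : Type*} [Fintype m]
    {p q : Submodule K (Matrix m m K)} (h : p ≤ q) : commSpan K p ≤ commSpan K q :=
  Submodule.span_mono fun _ ⟨x, hx, y, hy, hz⟩ => ⟨x, h hx, y, h hy, hz⟩

theorem zeroDiagSymm_le_symmSubmodule (K : Type*) [Field K] (m : Type*) :
    zeroDiagSymm K m ≤ symmSubmodule K m :=
  fun _ hX => hX.1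

/-- In characteristic 2, commutators of symmetric matrices are symmetric with zero diagonal. -/
theorem commSpan_symmSubmodule_le (K : Type*) [Field K] [CharP K 2] (m : Type*) [Fintype m] :
    commSpan K (symmSubmodule K m) ≤ zeroDiagSymm K m := by
  refine Submodule.span_le.mpr ?_
  rintro _ ⟨x, hx, y, hy, rfl⟩
  have hx : xᵀ = x := hx
  have hy : yᵀ = y := hy
  have hxy : (x * y)ᵀ = y * x := by rw [transpose_mul, hx, hy]
  refine ⟨?_, fun i => ?_⟩
  · rw [IsSymm, transpose_sub, hxy, transpose_mul, hx, hy]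
    ext i j
    simp only [Matrix.sub_apply, CharTwo.sub_eq_add, add_comm]
  · rw [Matrix.sub_apply, ← hxy, transpose_apply, sub_self]

theorem single_add_single_mem_zeroDiagSymm {K : Type*} [Field K] {m : Type*} [DecidableEq m]
    {i j : m} (h : i ≠ j) (c : K) : single i j c + single j i c ∈ zeroDiagSymm K m := by
  refine ⟨?_, fun a => ?_⟩
  · rw [IsSymm, transpose_add, transpose_single, transpose_single, add_comm]
  · simp only [Matrix.add_apply, single_apply]
    grind

theorem single_add_single_mem_commSpan {K : Type*} [Field K] [CharP K 2] {m : Type*} [Fintype m]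
    [DecidableEq m] {i j k : m} (hij : i ≠ j) (hik : i ≠ k) (hkj : k ≠ j) (c : K) :
    single i j c + single j i c ∈ commSpan K (zeroDiagSymm K m) := by
  refine Submodule.subset_span ⟨_, single_add_single_mem_zeroDiagSymm hik c,
    _, single_add_single_mem_zeroDiagSymm hkj 1, ?_⟩
  have hneg : single j i c = -single j i c := by
    ext a b
    rw [Matrix.neg_apply, CharTwo.neg_eq]
  simp [add_mul, mul_add, hij, hik, hkj, hij.symm, hik.symm, hkj.symm, sub_eq_add_neg, ← hneg]

/-- A symmetric matrix with zero diagonal is the sum of the matrices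
`X i j • (single i j 1 + single j i 1)` over `i < j`. -/
theorem eq_sum_single_add_single {K : Type*} [Field K] {m : Type*} [Fintype m] [LinearOrder m]
    {X : Matrix m m K} (hX : X ∈ zeroDiagSymm K m) :
    X = ∑ i, ∑ j, (single i j (if i < j then X i j else 0) +
      single j i (if i < j then X i j else 0)) := by
  set U : Matrix m m K := of fun i j => if i < j then X i j else 0 with hU
  have hXU : X = U + Uᵀ := by
    ext i j
    have hji : X j i = X i j := hX.1.apply i j
    rcases lt_trichotomy i j with h | rfl | h
    · simp [hU, h, h.not_gt]
    · simp [hU, hX.2 i]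
    · simp [hU, h, h.not_gt, hji]
  conv_lhs => rw [hXU, matrix_eq_sum_single U]
  simp [transpose_sum, Finset.sum_add_distrib, hU]

theorem zeroDiagSymm_le_commSpan (K : Type*) [Field K] [CharP K 2] (m : Type*) [Fintype m]
    [LinearOrder m] (hm : 2 < Fintype.card m) :
    zeroDiagSymm K m ≤ commSpan K (zeroDiagSymm K m) := by
  intro X hX
  rw [eq_sum_single_add_single hX]
  refine Submodule.sum_mem _ fun i _ => Submodule.sum_mem _ fun j _ => ?_
  split_ifs with hij
  · obtain ⟨k, hk⟩ : ∃ k, k ∉ ({i, j} : Finset m) := by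
      by_contra! h
      have := Finset.card_le_two (a := i) (b := j)
      rw [Finset.eq_univ_iff_forall.mpr h, Finset.card_univ] at this
      omega
    simp only [Finset.mem_insert, Finset.mem_singleton, not_or] at hk
    exact single_add_single_mem_commSpan hij.ne (Ne.symm hk.1) hk.2 _
  · simp

/-- Over a field of characteristic 2 and for `n > 2`, the derived algebra
`o_I⁽¹⁾(n) = [o_I(n), o_I(n)]` equals `ZD(n)`, the space of symmetric zero-diagonal matrices,
and `o_I⁽²⁾(n) = o_I⁽¹⁾(n)`. -/
theorem derived_oI_eq_ZD
    (K : Type*) [Field K] [CharP K 2] (n : ℕ) (hn : 2 < n) :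
    ((commSpan K (symmSubmodule K (Fin n)) : Set (Matrix (Fin n) (Fin n) K)) =
        {X : Matrix (Fin n) (Fin n) K | X.IsSymm ∧ ∀ i, X i i = 0}) ∧
    commSpan K (commSpan K (symmSubmodule K (Fin n))) =
        commSpan K (symmSubmodule K (Fin n)) := by
  have hZD := zeroDiagSymm_le_commSpan K (Fin n) (by simpa using hn)
  have hmono := commSpan_mono (zeroDiagSymm_le_symmSubmodule K (Fin n))
  have hderived : commSpan K (symmSubmodule K (Fin n)) = zeroDiagSymm K (Fin n) :=
    le_antisymm (commSpan_symmSubmodule_le K (Fin n)) (hZD.trans hmono)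
  rw [hderived] at hmono ⊢
  exact ⟨rfl, le_antisymm hmono hZD⟩
end

section
/- Let K be an algebraically closed field of characteristic 2, and let n₀, n₁ ≥ 1 with n = n₀ + n₁ ≥ 3. Let g be the space of all symmetric n×n matrices over K, with the block grading (blocks of sizes n₀ and n₁): even part g₀ = {diag-block matrices [[A₀,0],[0,A₁]] with A₀, A₁ symmetric}, odd part g₁ = {matrices [[0,Cᵀ],[C,0]] with C an arbitrary n₁×n₀ matrix}. Then the derived superalgebra D(g) equals the space of all symmetric n×n matrices over K of trace 0, and D(D(g)) = D(g). -/
open Matrix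

/-- The odd part of `gl` with respect to the block structure: matrices with vanishing
diagonal blocks. -/
def oddPart (K : Type*) [Field K] (ι₀ ι₁ : Type*) :
    Submodule K (Matrix (ι₀ ⊕ ι₁) (ι₀ ⊕ ι₁) K) where
  carrier := {X | (∀ i j, X (Sum.inl i) (Sum.inl j) = 0) ∧ ∀ i j, X (Sum.inr i) (Sum.inr j) = 0}
  add_mem' := by
    rintro a b ⟨ha0, ha1⟩ ⟨hb0, hb1⟩
    exact ⟨fun i j => by simp [Matrix.add_apply, ha0 i j, hb0 i j],
      fun i j => by simp [Matrix.add_apply, ha1 i j, hb1 i j]⟩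
  zero_mem' := ⟨fun i j => rfl, fun i j => rfl⟩
  smul_mem' := by
    rintro c a ⟨ha0, ha1⟩
    exact ⟨fun i j => by simp [Matrix.smul_apply, ha0 i j],
      fun i j => by simp [Matrix.smul_apply, ha1 i j]⟩

/-- The derived superalgebra of a block-graded subspace `g` of matrices over a field of
characteristic 2: `D(g) = Span({XY − YX : X, Y ∈ g} ∪ {L² : L ∈ g₁})`, where the odd part
`g₁` is `g ∩ oddPart`. -/
def superDerived (K : Type*) [Field K] {ι₀ ι₁ : Type*} [Fintype ι₀] [Fintype ι₁]
    [DecidableEq ι₀] [DecidableEq ι₁]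
    (p : Submodule K (Matrix (ι₀ ⊕ ι₁) (ι₀ ⊕ ι₁) K)) :
    Submodule K (Matrix (ι₀ ⊕ ι₁) (ι₀ ⊕ ι₁) K) :=
  Submodule.span K ({z | ∃ x ∈ p, ∃ y ∈ p, z = x * y - y * x} ∪
    {z | ∃ l ∈ p ⊓ oddPart K ι₀ ι₁, z = l * l})

/-- The space of symmetric matrices, here the ortho-orthogonal Lie superalgebra
`oo_{II}(n₀|n₁)` preserving the form `diag(1_{n₀}, 1_{n₁})` in characteristic 2, with
even part the block-diagonal symmetric matrices and odd part the block-antidiagonal ones. -/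
def ooII (K : Type*) [Field K] (n₀ n₁ : ℕ) :
    Submodule K (Matrix (Fin n₀ ⊕ Fin n₁) (Fin n₀ ⊕ Fin n₁) K) where
  carrier := {X | X.IsSymm}
  add_mem' := fun ha hb => ha.add hb
  zero_mem' := isSymm_zero
  smul_mem' := fun c _ ha => ha.smul c

/-- In characteristic 2 a subspace containing all `E_ij + E_ji` with `i ≠ j`, and all
`E_ii + E_oo` for a fixed `o`, contains every symmetric matrix of trace 0. -/
theorem mem_of_isSymm_of_trace_eq_zero {K ι : Type*} [Field K] [Fintype ι] [DecidableEq ι]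
    (W : Submodule K (Matrix ι ι K)) (o : ι)
    (hoff : ∀ i j, i ≠ j → single i j (1 : K) + single j i 1 ∈ W)
    (hdiag : ∀ i, single i i (1 : K) + single o o 1 ∈ W)
    {X : Matrix ι ι K} (hX : X.IsSymm) (ht : X.trace = 0) : X ∈ W := by
  let e := Fintype.equivFin ι
  have hsplit : X = (∑ i, ∑ j, (if e i < e j then X i j else 0) •
      (single i j (1 : K) + single j i 1)) +
      ∑ i, X i i • (single i i (1 : K) + single o o 1) := by
    have ho : ∑ i, X i i • single o o (1 : K) = 0 := by
      rw [← Finset.sum_smul]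
      exact (congrArg (· • single o o (1 : K)) ht).trans (zero_smul _ _)
    simp only [smul_add, Finset.sum_add_distrib, ho, add_zero]
    ext a b
    have hab : X b a = X a b := hX.apply a b
    simp only [Matrix.add_apply, Matrix.sum_apply, Matrix.smul_apply, Matrix.single_apply,
      smul_eq_mul, mul_ite, mul_one, mul_zero, ite_and, Finset.sum_ite_eq',
      Finset.mem_univ, if_true, Finset.sum_ite_irrel, Finset.sum_const_zero]
    rcases lt_trichotomy (e a) (e b) with hlt | heq | hlt
    · have hne : a ≠ b := fun h => hlt.ne (congrArg e h)
      simp [hlt, hlt.not_gt, hne]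
    · obtain rfl := e.injective heq
      simp
    · have hne : a ≠ b := fun h => hlt.ne' (congrArg e h)
      simp [hlt, hlt.not_gt, hne, hab]
  rw [hsplit]
  refine W.add_mem (W.sum_mem fun i _ => W.sum_mem fun j _ => ?_)
    (W.sum_mem fun i _ => W.smul_mem _ (hdiag i))
  split_ifs with hij
  · exact W.smul_mem _ (hoff i j fun h => hij.ne (congrArg e h))
  · rw [zero_smul]
    exact W.zero_mem

theorem superDerived_le_of_le_ooII {K : Type*} [Field K] [CharP K 2] {n₀ n₁ : ℕ}
    {p : Submodule K (Matrix (Fin n₀ ⊕ Fin n₁) (Fin n₀ ⊕ Fin n₁) K)} (hp : p ≤ ooII K n₀ n₁)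
    {X : Matrix (Fin n₀ ⊕ Fin n₁) (Fin n₀ ⊕ Fin n₁) K} (hX : X ∈ superDerived K p) :
    X.IsSymm ∧ X.trace = 0 := by
  suffices hle : superDerived K p ≤ ooII K n₀ n₁ ⊓ LinearMap.ker (traceLinearMap _ K K) from
    hle hX
  refine Submodule.span_le.2 ?_
  rintro _ (⟨x, hx, y, hy, rfl⟩ | ⟨l, ⟨hl, h00, h11⟩, rfl⟩)
  · have hxs : xᵀ = x := hp hx
    have hys : yᵀ = y := hp hy
    refine ⟨?_, ?_⟩
    · change (x * y - y * x)ᵀ = x * y - y * x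
      rw [transpose_sub, transpose_mul, transpose_mul, hxs, hys]
      ext i j
      simp only [Matrix.sub_apply, CharTwo.sub_eq_add]
      exact add_comm _ _
    · change (x * y - y * x).trace = 0
      rw [trace_sub, trace_mul_comm, sub_self]
  · have hls : lᵀ = l := hp hl
    refine ⟨?_, ?_⟩
    · change (l * l)ᵀ = l * l
      rw [transpose_mul, hls]
    · change (l * l).trace = 0
      simp only [trace, diag_apply, mul_apply, Fintype.sum_sum_type, h00, h11, mul_zero,
        Finset.sum_const_zero, zero_add, add_zero]
      rw [Finset.sum_comm (s := (Finset.univ : Finset (Fin n₁)))]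
      simp only [mul_comm (l (Sum.inr _) (Sum.inl _))]
      exact CharTwo.add_self_eq_zero _

theorem mem_superDerived_of_isSymm_of_trace_eq_zero {K : Type*} [Field K] [CharP K 2]
    {n₀ n₁ : ℕ} (h0 : 1 ≤ n₀) (h1 : 1 ≤ n₁) (h : 3 ≤ n₀ + n₁)
    {p : Submodule K (Matrix (Fin n₀ ⊕ Fin n₁) (Fin n₀ ⊕ Fin n₁) K)}
    (hp : ∀ X : Matrix (Fin n₀ ⊕ Fin n₁) (Fin n₀ ⊕ Fin n₁) K,
      X.IsSymm → X.trace = 0 → X ∈ p)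
    {X : Matrix (Fin n₀ ⊕ Fin n₁) (Fin n₀ ⊕ Fin n₁) K} (hX : X.IsSymm) (ht : X.trace = 0) :
    X ∈ superDerived K p := by
  have hmem : ∀ i j, i ≠ j → single i j (1 : K) + single j i 1 ∈ p := by
    intro i j hij
    apply hp
    · change (_)ᵀ = _
      rw [transpose_add, transpose_single, transpose_single, add_comm]
    · rw [trace_add, trace_single_eq_of_ne _ _ _ hij, trace_single_eq_of_ne _ _ _ hij.symm,
        add_zero]
  have hsq : ∀ a b, single (Sum.inl a) (Sum.inl a) (1 : K) + single (Sum.inr b) (Sum.inr b) 1 ∈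
      superDerived K p := by
    intro a b
    refine Submodule.subset_span (Or.inr ⟨single (Sum.inl a) (Sum.inr b) 1 +
      single (Sum.inr b) (Sum.inl a) 1, ⟨hmem _ _ (by simp), ?_, ?_⟩, ?_⟩)
    · intro i j
      simp
    · intro i j
      simp
    · simp [add_mul, mul_add, add_comm]
  refine mem_of_isSymm_of_trace_eq_zero _ (Sum.inr ⟨0, h1⟩) ?_ ?_ hX ht
  · intro i j hij
    obtain ⟨k, hk⟩ : ∃ k, k ∉ ({i, j} : Finset (Fin n₀ ⊕ Fin n₁)) := by
      apply Finset.exists_mem_notMem_of_card_lt_card (t := Finset.univ) _ |>.imp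
      · exact fun _ hk => hk.2
      · have := Finset.card_le_two (a := i) (b := j)
        simp only [Finset.card_univ, Fintype.card_sum, Fintype.card_fin]
        omega
    simp only [Finset.mem_insert, Finset.mem_singleton, not_or] at hk
    refine Submodule.subset_span (Or.inl ⟨_, hmem i k (Ne.symm hk.1), _, hmem k j hk.2, ?_⟩)
    ext a b
    simp [add_mul, mul_add, hij, hij.symm, hk.1, hk.2, Ne.symm hk.1, Ne.symm hk.2,
      CharTwo.sub_eq_add]
  · rintro (a | b)
    · exact hsq a _
    · convert Submodule.add_mem _ (hsq ⟨0, h0⟩ b) (hsq ⟨0, h0⟩ ⟨0, h1⟩) using 1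
      ext i j
      simp only [Matrix.add_apply]
      linear_combination -CharTwo.add_self_eq_zero
        (single (Sum.inl ⟨0, h0⟩) (Sum.inl ⟨0, h0⟩) (1 : K) i j)

/-- For `n = n₀ + n₁ ≥ 3`, the derived superalgebra of `oo_{II}(n₀|n₁)` is the space of all
symmetric matrices of trace 0, and the second derived superalgebra equals the first. -/
theorem derived_ooII
    (K : Type*) [Field K] [IsAlgClosed K] [CharP K 2] (n₀ n₁ : ℕ)
    (h0 : 1 ≤ n₀) (h1 : 1 ≤ n₁) (h : 3 ≤ n₀ + n₁) :
    ((superDerived K (ooII K n₀ n₁) : Set (Matrix (Fin n₀ ⊕ Fin n₁) (Fin n₀ ⊕ Fin n₁) K)) =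
      {X | X.IsSymm ∧ X.trace = 0}) ∧
    superDerived K (superDerived K (ooII K n₀ n₁)) = superDerived K (ooII K n₀ n₁) := by
  have hD : ∀ X, X ∈ superDerived K (ooII K n₀ n₁) ↔ X.IsSymm ∧ X.trace = 0 := fun X =>
    ⟨superDerived_le_of_le_ooII le_rfl, fun hX =>
      mem_superDerived_of_isSymm_of_trace_eq_zero h0 h1 h (fun _ hY _ => hY) hX.1 hX.2⟩
  refine ⟨Set.ext hD, Submodule.ext fun X => ⟨fun hX => ?_, fun hX => ?_⟩⟩
  · exact (hD X).2 (superDerived_le_of_le_ooII (fun Y hY => ((hD Y).1 hY).1) hX)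
  · exact mem_superDerived_of_isSymm_of_trace_eq_zero h0 h1 h
      (fun Y hY ht => (hD Y).2 ⟨hY, ht⟩) ((hD X).1 hX).1 ((hD X).1 hX).2
end

section
/- Let K be an algebraically closed field of characteristic 2, let n₀ ≥ 1, and let n₁ ≥ 2 be even. Let g ⊂ gl(n₀+n₁, K) consist of all block matrices [[A₀, Cᵀ Π_{n₁}],[C, Π_{n₁} A₁]] with A₀ a symmetric n₀×n₀ matrix, A₁ a symmetric n₁×n₁ matrix, and C an arbitrary n₁×n₀ matrix; its even part g₀ consists of those elements with C = 0 and its odd part g₁ of those with A₀ = 0 and A₁ = 0. Then the derived superalgebra D(g) equals the set of elements of g with A₀ zero-diagonal, and D(D(g)) = D(g). -/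
open Matrix

/-- The form `Π_{2k} = [[0,1_k],[1_k,0]]`. -/
def PiB (K : Type*) [Field K] (k : ℕ) : Matrix (Fin k ⊕ Fin k) (Fin k ⊕ Fin k) K :=
  Matrix.fromBlocks 0 1 1 0

/-- The ortho-orthogonal Lie superalgebra `oo_{IΠ}(n₀|n₁)` (with `n₁ = 2k₁`) preserving the
even symmetric form `diag(1_{n₀}, Π_{n₁})` in characteristic 2: block matrices
`[[A₀, Cᵀ Π_{n₁}],[C, Π_{n₁} A₁]]` with `A₀, A₁` symmetric and `C` arbitrary. -/
def ooIPi (K : Type*) [Field K] (n₀ k₁ : ℕ) :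
    Submodule K (Matrix (Fin n₀ ⊕ (Fin k₁ ⊕ Fin k₁)) (Fin n₀ ⊕ (Fin k₁ ⊕ Fin k₁)) K) where
  carrier := {X | ∃ (A₀ : Matrix (Fin n₀) (Fin n₀) K)
      (A₁ : Matrix (Fin k₁ ⊕ Fin k₁) (Fin k₁ ⊕ Fin k₁) K)
      (C : Matrix (Fin k₁ ⊕ Fin k₁) (Fin n₀) K),
    A₀.IsSymm ∧ A₁.IsSymm ∧ X = Matrix.fromBlocks A₀ (Cᵀ * PiB K k₁) C (PiB K k₁ * A₁)}
  add_mem' := by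
    rintro a b ⟨A1, B1, C1, hA1, hB1, rfl⟩ ⟨A2, B2, C2, hA2, hB2, rfl⟩
    exact ⟨A1 + A2, B1 + B2, C1 + C2, hA1.add hA2, hB1.add hB2,
      by rw [Matrix.fromBlocks_add, Matrix.transpose_add, Matrix.add_mul, Matrix.mul_add]⟩
  zero_mem' := ⟨0, 0, 0, isSymm_zero, isSymm_zero, by simp⟩
  smul_mem' := by
    rintro c a ⟨A1, B1, C1, hA1, hB1, rfl⟩
    exact ⟨c • A1, c • B1, c • C1, hA1.smul c, hB1.smul c,
      by rw [Matrix.fromBlocks_smul, Matrix.transpose_smul, Matrix.smul_mul, Matrix.mul_smul]⟩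

section Auxiliary

variable {K : Type*} [Field K]

/-- The elements of `oo_{IΠ}(n₀|n₁)` whose block `A₀` is zero-diagonal. -/
def zeroDiagOoIPi (K : Type*) [Field K] (n₀ k₁ : ℕ) :
    Submodule K (Matrix (Fin n₀ ⊕ (Fin k₁ ⊕ Fin k₁)) (Fin n₀ ⊕ (Fin k₁ ⊕ Fin k₁)) K) where
  carrier := {X | X ∈ ooIPi K n₀ k₁ ∧ ∀ i, X (Sum.inl i) (Sum.inl i) = 0}
  add_mem' := fun ha hb => ⟨add_mem ha.1 hb.1, fun i => by simp [ha.2 i, hb.2 i]⟩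
  zero_mem' := ⟨zero_mem _, fun _ => rfl⟩
  smul_mem' := fun c _ ha => ⟨Submodule.smul_mem _ c ha.1, fun i => by simp [ha.2 i]⟩

theorem Matrix.neg_eq_of_charTwo [CharP K 2] {m n : Type*} (M : Matrix m n K) : -M = M := by
  ext i j
  exact CharTwo.neg_eq _

theorem Matrix.add_self_of_charTwo [CharP K 2] {m n : Type*} (M : Matrix m n K) : M + M = 0 := by
  ext i j
  exact CharTwo.add_self_eq_zero _

theorem transpose_PiB (k : ℕ) : (PiB K k)ᵀ = PiB K k := by
  simp [PiB, fromBlocks_transpose]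

theorem PiB_mul_PiB (k : ℕ) : PiB K k * PiB K k = 1 := by
  simp [PiB, fromBlocks_multiply]

theorem PiB_mul_PiB_mul {ι : Type*} (k : ℕ) (M : Matrix (Fin k ⊕ Fin k) ι K) :
    PiB K k * (PiB K k * M) = M := by
  rw [← Matrix.mul_assoc, PiB_mul_PiB, Matrix.one_mul]

theorem mem_ooIPi_iff {n₀ k₁ : ℕ}
    {X : Matrix (Fin n₀ ⊕ (Fin k₁ ⊕ Fin k₁)) (Fin n₀ ⊕ (Fin k₁ ⊕ Fin k₁)) K} :
    X ∈ ooIPi K n₀ k₁ ↔ (fromBlocks 1 0 0 (PiB K k₁) * X).IsSymm := by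
  constructor
  · rintro ⟨A, B, C, hA, hB, rfl⟩
    simp only [IsSymm, fromBlocks_multiply, fromBlocks_transpose, Matrix.one_mul,
      Matrix.zero_mul, add_zero, zero_add, PiB_mul_PiB_mul, transpose_mul, transpose_PiB,
      transpose_transpose, hA.eq, hB.eq]
  · intro h
    rw [← fromBlocks_toBlocks X] at h ⊢
    simp only [IsSymm, fromBlocks_multiply, fromBlocks_transpose, Matrix.one_mul,
      Matrix.zero_mul, add_zero, zero_add, fromBlocks_inj] at h
    obtain ⟨h₁, h₂, -, h₄⟩ := h
    refine ⟨X.toBlocks₁₁, PiB K k₁ * X.toBlocks₂₂, X.toBlocks₂₁, h₁, h₄, ?_⟩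
    rw [PiB_mul_PiB_mul, ← h₂, transpose_mul, transpose_PiB]

theorem mem_ooIPi_iff' {n₀ k₁ : ℕ}
    {X : Matrix (Fin n₀ ⊕ (Fin k₁ ⊕ Fin k₁)) (Fin n₀ ⊕ (Fin k₁ ⊕ Fin k₁)) K} :
    X ∈ ooIPi K n₀ k₁ ↔
      Xᵀ * fromBlocks 1 0 0 (PiB K k₁) = fromBlocks 1 0 0 (PiB K k₁) * X := by
  rw [mem_ooIPi_iff, IsSymm, transpose_mul, fromBlocks_transpose, transpose_PiB]
  simp

theorem dotProduct_PiB_mulVec_self [CharP K 2] (k : ℕ) (v : Fin k ⊕ Fin k → K) :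
    v ⬝ᵥ (PiB K k *ᵥ v) = 0 := by
  simp only [PiB, dotProduct, fromBlocks_mulVec, Fintype.sum_sum_type, Sum.elim_inl,
    Sum.elim_inr, zero_mulVec, one_mulVec, zero_add, add_zero, Function.comp_apply]
  simp_rw [mul_comm (v (Sum.inr _))]
  exact CharTwo.add_self_eq_zero _

theorem superDerived_mono {ι₀ ι₁ : Type*} [Fintype ι₀] [Fintype ι₁] [DecidableEq ι₀]
    [DecidableEq ι₁] {p q : Submodule K (Matrix (ι₀ ⊕ ι₁) (ι₀ ⊕ ι₁) K)} (h : p ≤ q) :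
    superDerived K p ≤ superDerived K q := by
  refine Submodule.span_mono (Set.union_subset_union ?_ ?_)
  · rintro z ⟨x, hx, y, hy, rfl⟩
    exact ⟨x, h hx, y, h hy, rfl⟩
  · rintro z ⟨l, hl, rfl⟩
    exact ⟨l, ⟨h hl.1, hl.2⟩, rfl⟩

theorem superDerived_ooIPi_le [CharP K 2] (n₀ k₁ : ℕ) :
    superDerived K (ooIPi K n₀ k₁) ≤ zeroDiagOoIPi K n₀ k₁ := by
  refine Submodule.span_le.2 (Set.union_subset ?_ ?_)
  · rintro z ⟨X, hX, Y, hY, rfl⟩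
    refine ⟨?_, fun i => ?_⟩
    · rw [mem_ooIPi_iff'] at hX hY
      rw [mem_ooIPi_iff', transpose_sub, transpose_mul, transpose_mul,
        Matrix.sub_mul, Matrix.mul_sub, Matrix.mul_assoc, Matrix.mul_assoc, hX, hY,
        ← Matrix.mul_assoc, hY, ← Matrix.mul_assoc, hX, Matrix.mul_assoc, Matrix.mul_assoc,
        ← neg_sub, Matrix.neg_eq_of_charTwo]
    · obtain ⟨A, B, C, hA, hB, rfl⟩ := hX
      obtain ⟨A', B', C', hA', hB', rfl⟩ := hY
      have hT : (A' * A + C'ᵀ * PiB K k₁ * C)ᵀ = A * A' + Cᵀ * PiB K k₁ * C' := by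
        simp only [transpose_add, transpose_mul, hA.eq, hA'.eq, transpose_PiB,
          transpose_transpose, Matrix.mul_assoc]
      rw [fromBlocks_multiply, fromBlocks_multiply, Matrix.sub_apply, fromBlocks_apply₁₁,
        fromBlocks_apply₁₁, ← hT, transpose_apply, sub_self]
  · rintro z ⟨L, ⟨hL, hodd⟩, rfl⟩
    refine ⟨?_, fun i => ?_⟩
    · rw [SetLike.mem_coe, mem_ooIPi_iff'] at hL
      rw [mem_ooIPi_iff', transpose_mul, Matrix.mul_assoc, hL,
        ← Matrix.mul_assoc, hL, Matrix.mul_assoc]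
    · obtain ⟨A, B, C, hA, hB, rfl⟩ := hL
      have hA0 : A = 0 := by
        ext i j
        exact hodd.1 i j
      subst hA0
      rw [fromBlocks_multiply, fromBlocks_apply₁₁, Matrix.zero_mul, zero_add,
        Matrix.mul_assoc]
      exact dotProduct_PiB_mulVec_self k₁ (fun a => C a i)

/-- A symmetric zero-diagonal matrix is of the form `N + Nᵀ`. -/
theorem Matrix.IsSymm.exists_eq_add_transpose {ι R : Type*} [AddMonoid R] {A : Matrix ι ι R}
    (hA : A.IsSymm) (hd : ∀ i, A i i = 0) : ∃ N : Matrix ι ι R, A = N + Nᵀ := by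
  classical
  let : LinearOrder ι := linearOrderOfSTO WellOrderingRel
  refine ⟨Matrix.of fun i j => if i < j then A i j else 0, ?_⟩
  ext i j
  rcases lt_trichotomy i j with h | h | h
  · simp [h, h.not_gt]
  · simp [h, hd]
  · simp [h, h.not_gt, hA.apply i j]

section Perfect

variable {n₀ k₁ : ℕ}

theorem odd_mem_zeroDiagOoIPi (C : Matrix (Fin k₁ ⊕ Fin k₁) (Fin n₀) K) :
    fromBlocks 0 (Cᵀ * PiB K k₁) C 0 ∈ zeroDiagOoIPi K n₀ k₁ :=
  ⟨⟨0, 0, C, isSymm_zero, isSymm_zero, by rw [Matrix.mul_zero]⟩, fun _ => rfl⟩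

theorem odd_mem_superDerived [CharP K 2] (C : Matrix (Fin k₁ ⊕ Fin k₁) (Fin n₀) K) :
    fromBlocks 0 (Cᵀ * PiB K k₁) C 0 ∈ superDerived K (zeroDiagOoIPi K n₀ k₁) := by
  refine Submodule.subset_span (Or.inl ⟨fromBlocks 0 0 0 1,
    ⟨⟨0, PiB K k₁, 0, isSymm_zero, transpose_PiB k₁, ?_⟩, fun _ => rfl⟩, _,
    odd_mem_zeroDiagOoIPi C, ?_⟩)
  · simp [PiB_mul_PiB]
  · rw [fromBlocks_multiply, fromBlocks_multiply, sub_eq_add_neg, fromBlocks_neg, fromBlocks_add]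
    simp [Matrix.neg_eq_of_charTwo (Cᵀ * PiB K k₁)]

theorem vecMulVec_self_mem_superDerived [CharP K 2] (h0 : 1 ≤ n₀) (w : Fin k₁ ⊕ Fin k₁ → K) :
    fromBlocks 0 0 0 (PiB K k₁ * vecMulVec w w) ∈ superDerived K (zeroDiagOoIPi K n₀ k₁) := by
  set v := PiB K k₁ *ᵥ w with hv
  set e : Fin n₀ → K := Pi.single ⟨0, h0⟩ 1 with he
  have hvv : v ⬝ᵥ (PiB K k₁ *ᵥ v) = 0 := dotProduct_PiB_mulVec_self k₁ v
  refine Submodule.subset_span (Or.inr ⟨_,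
    ⟨odd_mem_zeroDiagOoIPi (vecMulVec v e), fun _ _ => rfl, fun _ _ => rfl⟩, ?_⟩)
  have h₁ : (vecMulVec v e)ᵀ * PiB K k₁ * vecMulVec v e = 0 := by
    rw [transpose_vecMulVec, Matrix.mul_assoc, mul_vecMulVec, vecMulVec_mul_vecMulVec, hvv]
    simp
  have h₂ : vecMulVec v e * ((vecMulVec v e)ᵀ * PiB K k₁) = PiB K k₁ * vecMulVec w w := by
    rw [transpose_vecMulVec, ← Matrix.mul_assoc, vecMulVec_mul_vecMulVec, vecMulVec_mul,
      mul_vecMulVec, ← mulVec_transpose, transpose_PiB]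
    simp [he, hv, mulVec_mulVec, PiB_mul_PiB]
  rw [fromBlocks_multiply, h₁, h₂]
  simp

theorem vecMulVec_add_mem_superDerived [CharP K 2] (h0 : 1 ≤ n₀) (u w : Fin k₁ ⊕ Fin k₁ → K) :
    fromBlocks 0 0 0 (PiB K k₁ * (vecMulVec u w + vecMulVec w u)) ∈
      superDerived K (zeroDiagOoIPi K n₀ k₁) := by
  have h := sub_mem (sub_mem (vecMulVec_self_mem_superDerived h0 (u + w))
    (vecMulVec_self_mem_superDerived h0 u)) (vecMulVec_self_mem_superDerived h0 w)
  convert h using 1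
  simp only [sub_eq_add_neg, fromBlocks_neg, fromBlocks_add, ← Matrix.mul_neg, ← Matrix.mul_add,
    vecMulVec_add, add_vecMulVec, neg_zero, add_zero]
  congr 2
  abel

theorem evenRight_mem_superDerived [CharP K 2] (h0 : 1 ≤ n₀)
    {B : Matrix (Fin k₁ ⊕ Fin k₁) (Fin k₁ ⊕ Fin k₁) K} (hB : B.IsSymm) :
    fromBlocks 0 0 0 (PiB K k₁ * B) ∈ superDerived K (zeroDiagOoIPi K n₀ k₁) := by
  have hT : ∀ N : Matrix (Fin k₁ ⊕ Fin k₁) (Fin k₁ ⊕ Fin k₁) K,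
      fromBlocks 0 0 0 (PiB K k₁ * (N + Nᵀ)) ∈ superDerived K (zeroDiagOoIPi K n₀ k₁) := by
    intro N
    induction N using Matrix.induction_on' with
    | h_zero => simp
    | h_add p q hp hq =>
      convert add_mem hp hq using 1
      simp only [fromBlocks_add, ← Matrix.mul_add, add_zero, transpose_add]
      congr 2
      abel
    | h_std_basis i j x =>
      convert vecMulVec_add_mem_superDerived h0 (Pi.single i x) (Pi.single j 1) using 4
      · ext a b
        simp [single_apply, vecMulVec_apply, Pi.single_apply, eq_comm, ← ite_and, and_comm]
      · ext a b
        simp [single_apply, vecMulVec_apply, Pi.single_apply, ite_and, eq_comm]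
  have hD : ∀ d : Fin k₁ ⊕ Fin k₁ → K,
      fromBlocks 0 0 0 (PiB K k₁ * diagonal d) ∈ superDerived K (zeroDiagOoIPi K n₀ k₁) := by
    intro d
    have h := sum_mem (fun i (_ : i ∈ Finset.univ) => Submodule.smul_mem _ (d i)
      (vecMulVec_self_mem_superDerived (K := K) h0 (Pi.single i 1)))
    convert h using 1
    have hs : ∀ i, d i • fromBlocks (0 : Matrix (Fin n₀) (Fin n₀) K) 0 0
        (PiB K k₁ * vecMulVec (Pi.single i 1) (Pi.single i 1)) =
        fromBlocks 0 0 0 (PiB K k₁ * single i i (d i)) := by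
      intro i
      rw [← single_eq_single_vecMulVec_single, fromBlocks_smul, ← Matrix.mul_smul, smul_single]
      simp
    simp only [hs]
    have hadd : ∀ M N, fromBlocks (0 : Matrix (Fin n₀) (Fin n₀) K) 0 0 (PiB K k₁ * (M + N)) =
        fromBlocks 0 0 0 (PiB K k₁ * M) + fromBlocks 0 0 0 (PiB K k₁ * N) := by
      intro M N
      simp [fromBlocks_add, Matrix.mul_add]
    rw [← sum_single_eq_diagonal]
    exact map_sum (AddMonoidHom.mk' (fun M => fromBlocks (0 : Matrix (Fin n₀) (Fin n₀) K) 0 0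
      (PiB K k₁ * M)) hadd) _ _
  obtain ⟨N, hN⟩ := Matrix.IsSymm.exists_eq_add_transpose (hB.sub (isSymm_diagonal B.diag))
    (fun i => by simp)
  have h := add_mem (hT N) (hD B.diag)
  rw [← hN, fromBlocks_add, ← Matrix.mul_add, sub_add_cancel] at h
  simpa using h

theorem evenLeft_transpose_mul_mem_superDerived [CharP K 2] (h0 : 1 ≤ n₀)
    (C D : Matrix (Fin k₁ ⊕ Fin k₁) (Fin n₀) K) :
    fromBlocks (Cᵀ * PiB K k₁ * D + (Cᵀ * PiB K k₁ * D)ᵀ) 0 0 0 ∈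
      superDerived K (zeroDiagOoIPi K n₀ k₁) := by
  have hb : _ ∈ superDerived K (zeroDiagOoIPi K n₀ k₁) := Submodule.subset_span
    (Or.inl ⟨_, odd_mem_zeroDiagOoIPi C, _, odd_mem_zeroDiagOoIPi D, rfl⟩)
  have hB : (PiB K k₁ * (C * Dᵀ + (C * Dᵀ)ᵀ) * PiB K k₁).IsSymm := by
    simp [IsSymm, transpose_PiB, Matrix.mul_assoc, Matrix.mul_add, Matrix.add_mul, add_comm]
  convert sub_mem hb (evenRight_mem_superDerived h0 hB) using 1
  simp only [fromBlocks_multiply, sub_eq_add_neg, Matrix.neg_eq_of_charTwo, fromBlocks_add,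
    Matrix.mul_assoc, PiB_mul_PiB_mul]
  simp only [Matrix.add_mul, transpose_mul, transpose_PiB, transpose_transpose, Matrix.mul_assoc,
    Matrix.zero_mul, Matrix.mul_zero, zero_add, add_zero, Matrix.add_self_of_charTwo]

theorem evenLeft_mem_superDerived [CharP K 2] (h0 : 1 ≤ n₀) (h1 : 1 ≤ k₁)
    {A : Matrix (Fin n₀) (Fin n₀) K} (hA : A.IsSymm) (hd : ∀ i, A i i = 0) :
    fromBlocks A 0 0 0 ∈ superDerived K (zeroDiagOoIPi K n₀ k₁) := by
  obtain ⟨N, rfl⟩ := hA.exists_eq_add_transpose hd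
  clear hA hd
  induction N using Matrix.induction_on' with
  | h_zero => simp
  | h_add p q hp hq =>
    convert add_mem hp hq using 1
    simp only [fromBlocks_add, add_zero, transpose_add]
    congr 1
    abel
  | h_std_basis i j x =>
    let a : Fin k₁ ⊕ Fin k₁ := Sum.inl ⟨0, h1⟩
    have h := evenLeft_transpose_mul_mem_superDerived (K := K) h0
      (PiB K k₁ * (single a i x : Matrix (Fin k₁ ⊕ Fin k₁) (Fin n₀) K)) (single a j 1)
    rwa [transpose_mul, transpose_PiB, transpose_single, Matrix.mul_assoc (single i a x),
      PiB_mul_PiB, Matrix.mul_one, single_mul_single_same, mul_one] at h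

theorem zeroDiagOoIPi_le_superDerived [CharP K 2] (h0 : 1 ≤ n₀) (h1 : 1 ≤ k₁) :
    zeroDiagOoIPi K n₀ k₁ ≤ superDerived K (zeroDiagOoIPi K n₀ k₁) := by
  rintro _ ⟨⟨A, B, C, hA, hB, rfl⟩, hd⟩
  have h := add_mem (add_mem (evenLeft_mem_superDerived h0 h1 hA hd) (odd_mem_superDerived C))
    (evenRight_mem_superDerived h0 hB)
  simpa [fromBlocks_add] using h

end Perfect

end Auxiliary

/-- For `n₀ ≥ 1` and `n₁ = 2k₁ ≥ 2` even, the derived superalgebra of `oo_{IΠ}(n₀|n₁)`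
consists of its elements with `A₀` zero-diagonal, and the second derived superalgebra equals
the first. -/
theorem derived_ooIPi
    (K : Type*) [Field K] [IsAlgClosed K] [CharP K 2] (n₀ k₁ : ℕ)
    (h0 : 1 ≤ n₀) (h1 : 1 ≤ k₁) :
    ((superDerived K (ooIPi K n₀ k₁) :
        Set (Matrix (Fin n₀ ⊕ (Fin k₁ ⊕ Fin k₁)) (Fin n₀ ⊕ (Fin k₁ ⊕ Fin k₁)) K)) =
      {X | ∃ (A₀ : Matrix (Fin n₀) (Fin n₀) K)
          (A₁ : Matrix (Fin k₁ ⊕ Fin k₁) (Fin k₁ ⊕ Fin k₁) K)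
          (C : Matrix (Fin k₁ ⊕ Fin k₁) (Fin n₀) K),
        A₀.IsSymm ∧ (∀ i, A₀ i i = 0) ∧ A₁.IsSymm ∧
        X = Matrix.fromBlocks A₀ (Cᵀ * PiB K k₁) C (PiB K k₁ * A₁)}) ∧
    superDerived K (superDerived K (ooIPi K n₀ k₁)) = superDerived K (ooIPi K n₀ k₁) := by
  have hle := superDerived_ooIPi_le (K := K) n₀ k₁
  have hge := zeroDiagOoIPi_le_superDerived (K := K) h0 h1
  have hsub : zeroDiagOoIPi K n₀ k₁ ≤ ooIPi K n₀ k₁ := fun _ h => h.1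
  have heq : superDerived K (ooIPi K n₀ k₁) = zeroDiagOoIPi K n₀ k₁ :=
    le_antisymm hle (hge.trans (superDerived_mono hsub))
  rw [heq]
  refine ⟨?_, le_antisymm ((superDerived_mono hsub).trans hle) hge⟩
  ext X
  constructor
  · rintro ⟨⟨A, B, C, hA, hB, rfl⟩, hd⟩
    exact ⟨A, B, C, hA, hd, hB, rfl⟩
  · rintro ⟨A, B, C, hA, hd, hB, rfl⟩
    exact ⟨⟨A, B, C, hA, hB, rfl⟩, hd⟩
end

section
/- Let K be an algebraically closed field of characteristic 2, and let n₀ = 2k₀ ≥ 2 and n₁ = 2k₁ ≥ 2 be even with n₀ + n₁ ≥ 6. Let g ⊂ gl(n₀+n₁, K) consist of all block matrices [[Π_{n₀}A₀, Π_{n₀}CᵀΠ_{n₁}],[C, Π_{n₁}A₁]] with A₀, A₁ symmetric and C an arbitrary n₁×n₀ matrix; its even part g₀ consists of those elements with C = 0 and its odd part g₁ of those with A₀ = 0 and A₁ = 0. Then: (i) D(g) = {elements of g with A₀ and A₁ zero-diagonal}; (ii) D²(g) = {elements of D(g) with Σ_{i=1}^{k₀}(Π_{n₀}A₀)_{ii}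 + Σ_{i=1}^{k₁}(Π_{n₁}A₁)_{ii} = 0} (vanishing of the "half-supertrace"); (iii) D³(g) = D²(g). -/
open Matrix

/-- The ortho-orthogonal Lie superalgebra `oo_{ΠΠ}(n₀|n₁)` (with `n₀ = 2k₀`, `n₁ = 2k₁`)
preserving the even symmetric form `diag(Π_{n₀}, Π_{n₁})` in characteristic 2: block matrices
`[[Π_{n₀}A₀, Π_{n₀}CᵀΠ_{n₁}],[C, Π_{n₁}A₁]]` with `A₀, A₁` symmetric and `C` arbitrary. -/
def ooPiPi (K : Type*) [Field K] (k₀ k₁ : ℕ) :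
    Submodule K (Matrix ((Fin k₀ ⊕ Fin k₀) ⊕ (Fin k₁ ⊕ Fin k₁))
      ((Fin k₀ ⊕ Fin k₀) ⊕ (Fin k₁ ⊕ Fin k₁)) K) where
  carrier := {X | ∃ (A₀ : Matrix (Fin k₀ ⊕ Fin k₀) (Fin k₀ ⊕ Fin k₀) K)
      (A₁ : Matrix (Fin k₁ ⊕ Fin k₁) (Fin k₁ ⊕ Fin k₁) K)
      (C : Matrix (Fin k₁ ⊕ Fin k₁) (Fin k₀ ⊕ Fin k₀) K),
    A₀.IsSymm ∧ A₁.IsSymm ∧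
    X = Matrix.fromBlocks (PiB K k₀ * A₀) (PiB K k₀ * Cᵀ * PiB K k₁) C (PiB K k₁ * A₁)}
  add_mem' := by
    rintro a b ⟨A1, B1, C1, hA1, hB1, rfl⟩ ⟨A2, B2, C2, hA2, hB2, rfl⟩
    exact ⟨A1 + A2, B1 + B2, C1 + C2, hA1.add hA2, hB1.add hB2,
      by simp [Matrix.fromBlocks_add, Matrix.mul_add, Matrix.add_mul, Matrix.transpose_add]⟩
  zero_mem' := ⟨0, 0, 0, isSymm_zero, isSymm_zero, by simp⟩
  smul_mem' := by
    rintro c a ⟨A1, B1, C1, hA1, hB1, rfl⟩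
    exact ⟨c • A1, c • B1, c • C1, hA1.smul c, hB1.smul c,
      by simp [Matrix.fromBlocks_smul, Matrix.mul_smul, Matrix.smul_mul,
        Matrix.transpose_smul]⟩

section Involution

variable {K n : Type*} [Field K]

/-- Matrices `X` that are symmetric with respect to the symmetric bilinear form given by the
permutation matrix of an involution `τ`. -/
def tauSymm (K : Type*) {n : Type*} [Field K] (τ : n → n) : Submodule K (Matrix n n K) where
  carrier := {X | ∀ i j, X (τ j) (τ i) = X i j}
  add_mem' := fun ha hb i j => by simp [ha i j, hb i j]
  zero_mem' := fun _ _ => rfl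
  smul_mem' := fun c a ha i j => by simp [ha i j]

/-- Elements of `tauSymm` whose associated bilinear form is alternating. -/
def tauAlt (K : Type*) {n : Type*} [Field K] (τ : n → n) : Submodule K (Matrix n n K) where
  carrier := {X | X ∈ tauSymm K τ ∧ ∀ i, X i (τ i) = 0}
  add_mem' := fun ha hb => ⟨add_mem ha.1 hb.1, fun i => by simp [ha.2 i, hb.2 i]⟩
  zero_mem' := ⟨zero_mem _, fun _ => rfl⟩
  smul_mem' := fun c a ha => ⟨Submodule.smul_mem _ c ha.1, fun i => by simp [ha.2 i]⟩

/-- The matrix whose associated bilinear form is the elementary symmetric one on `i, j`. -/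
def tauUnit (K : Type*) {n : Type*} [Field K] [DecidableEq n] (τ : n → n) (i j : n) :
    Matrix n n K :=
  single (τ i) j 1 + single (τ j) i 1

variable {τ : n → n} {X Y : Matrix n n K}

lemma tauUnit_comm [DecidableEq n] (i j : n) : tauUnit K τ i j = tauUnit K τ j i :=
  add_comm _ _

lemma tauUnit_mem_tauSymm [DecidableEq n] (hτ : Function.Involutive τ) (i j : n) :
    tauUnit K τ i j ∈ tauSymm K τ := fun a b => by
  simp only [tauUnit, Matrix.add_apply, single_apply, hτ.injective.eq_iff, ← hτ.eq_iff]
  rw [add_comm]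
  simp only [and_comm, eq_comm]

lemma tauUnit_mem_tauAlt [DecidableEq n] (hτ : Function.Involutive τ) {i j : n} (h : i ≠ j) :
    tauUnit K τ i j ∈ tauAlt K τ := by
  refine ⟨tauUnit_mem_tauSymm hτ i j, fun a => ?_⟩
  have h₁ : ¬ (τ i = a ∧ j = τ a) := by rintro ⟨rfl, rfl⟩; exact h (hτ i).symm
  have h₂ : ¬ (τ j = a ∧ i = τ a) := by rintro ⟨rfl, rfl⟩; exact h (hτ j)
  simp [tauUnit, h₁, h₂]

lemma single_mem_tauSymm [DecidableEq n] (hτ : Function.Involutive τ) (i : n) :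
    single (τ i) i (1 : K) ∈ tauSymm K τ := fun a b => by
  simp only [single_apply, hτ.injective.eq_iff, ← hτ.eq_iff]
  simp only [and_comm, eq_comm]

lemma sub_eq_add_of_charTwo [CharP K 2] (A B : Matrix n n K) : A - B = A + B := by
  ext
  simp [CharTwo.sub_eq_add]

variable [Fintype n]

lemma mul_apply_tau (hτ : Function.Involutive τ) (hX : X ∈ tauSymm K τ) (hY : Y ∈ tauSymm K τ)
    (i j : n) : (X * Y) (τ j) (τ i) = (Y * X) i j := by
  simp only [Matrix.mul_apply]
  rw [← Equiv.sum_comp hτ.toPerm]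
  refine Finset.sum_congr rfl fun k _ => ?_
  simp only [Function.Involutive.coe_toPerm, hX k j, hY i k, mul_comm]

lemma mul_sub_mul_mem_tauAlt [CharP K 2] (hτ : Function.Involutive τ) (hX : X ∈ tauSymm K τ)
    (hY : Y ∈ tauSymm K τ) : X * Y - Y * X ∈ tauAlt K τ := by
  refine ⟨fun i j => ?_, fun i => ?_⟩
  · simp only [Matrix.sub_apply, mul_apply_tau hτ hX hY, mul_apply_tau hτ hY hX,
      CharTwo.sub_eq_add, add_comm]
  · have := mul_apply_tau hτ hX hY i (τ i)
    rw [hτ] at this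
    simp [this]

lemma mul_self_mem_tauAlt [CharP K 2] (hτ : Function.Involutive τ) (hne : ∀ i, τ i ≠ i)
    (hX : X ∈ tauSymm K τ) : X * X ∈ tauAlt K τ := by
  refine ⟨fun i j => mul_apply_tau hτ hX hX i j, fun i => ?_⟩
  rw [Matrix.mul_apply]
  refine Finset.sum_involution (fun k _ => τ k) (fun k _ => ?_) (fun k _ _ => hne k)
    (fun _ _ => Finset.mem_univ _) (fun k _ => hτ k)
  have h₁ : X i (τ k) = X k (τ i) := by rw [← hX k (τ i), hτ]
  rw [h₁, hX i k, mul_comm (X k (τ i)), CharTwo.add_self_eq_zero]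

lemma sum_mul_apply_self [CharP K 2] (hτ : Function.Involutive τ) (hX : X ∈ tauAlt K τ)
    (hY : Y ∈ tauSymm K τ) : ∑ i, (X * Y) i i = 0 := by
  simp only [Matrix.mul_apply]
  rw [← Fintype.sum_prod_type' (f := fun i j => X i j * Y j i)]
  refine Finset.sum_involution (fun p _ => (τ p.2, τ p.1)) (fun p _ => ?_) (fun p _ hp he => ?_)
    (fun _ _ => Finset.mem_univ _) (fun p _ => by simp [hτ _])
  · simp only [hX.1 p.1 p.2, hY p.2 p.1, CharTwo.add_self_eq_zero]
  · obtain ⟨i, j⟩ := p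
    have hj : τ i = j := (Prod.mk.inj he).2
    exact hp (by simp [← hj, hX.2 i])

lemma mem_of_tauUnit_mem [DecidableEq n] (hτ : Function.Involutive τ)
    {p : Submodule K (Matrix n n K)} (hp : ∀ i j, i ≠ j → tauUnit K τ i j ∈ p)
    (hX : X ∈ tauAlt K τ) : X ∈ p := by
  have key : X = ∑ i, ∑ j, (if Fintype.equivFin n i < Fintype.equivFin n j then X (τ i) j else 0) •
      tauUnit K τ i j := by
    ext a b
    have h₁ : ∀ i, (τ i = a) = (i = τ a) := fun i => by rw [hτ.eq_iff]
    simp only [tauUnit, Matrix.sum_apply, Matrix.smul_apply, Matrix.add_apply, single_apply,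
      smul_eq_mul, mul_add, Finset.sum_add_distrib, ite_and, mul_ite, mul_one, mul_zero, h₁]
    have h₂ : X (τ b) (τ a) = X a b := hX.1 a b
    rcases lt_trichotomy (Fintype.equivFin n (τ a)) (Fintype.equivFin n b) with h | h | h
    · simp [h, h.not_gt, hτ a]
    · obtain rfl := (Fintype.equivFin n).injective h
      simp [hX.2 a]
    · simp [h, h.not_gt, h₂]
  rw [key]
  refine Submodule.sum_mem _ fun i _ => Submodule.sum_mem _ fun j _ => ?_
  by_cases hij : i = j
  · simp [hij]
  · exact Submodule.smul_mem _ _ (hp i j hij)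

lemma tauUnit_bracket [DecidableEq n] [CharP K 2] (hτ : Function.Involutive τ) {i j k : n}
    (hij : i ≠ j) (hik : τ i ≠ k) (hjk : τ j ≠ k) :
    tauUnit K τ i j * tauUnit K τ (τ j) k - tauUnit K τ (τ j) k * tauUnit K τ i j =
      tauUnit K τ i k := by
  have h₁ : i ≠ τ k := fun h => hik (by rw [h, hτ])
  have h₂ : j ≠ τ k := fun h => hjk (by rw [h, hτ])
  rw [sub_eq_add_of_charTwo]
  simp [tauUnit, mul_add, add_mul, hτ j, hij, h₁, h₂, hik.symm, hjk.symm,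
    hτ.injective.ne hij.symm]

lemma tauUnit_bracket_tau [DecidableEq n] [CharP K 2] (hτ : Function.Involutive τ) {i j : n}
    (hij : i ≠ j) :
    tauUnit K τ i j * tauUnit K τ (τ j) (τ i) - tauUnit K τ (τ j) (τ i) * tauUnit K τ i j =
      tauUnit K τ i (τ i) + tauUnit K τ j (τ j) := by
  rw [sub_eq_add_of_charTwo]
  simp [tauUnit, mul_add, add_mul, hτ i, hτ j, hij, hij.symm, hτ.injective.eq_iff]
  abel

lemma single_bracket_tau [DecidableEq n] [CharP K 2] (hτ : Function.Involutive τ) (i : n) :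
    single (τ i) i (1 : K) * single (τ (τ i)) (τ i) 1 -
      single (τ (τ i)) (τ i) (1 : K) * single (τ i) i 1 = tauUnit K τ i (τ i) := by
  rw [sub_eq_add_of_charTwo]
  simp [tauUnit, hτ i]

end Involution

section SuperDerived

variable {K ι₀ ι₁ : Type*} [Field K] [Fintype ι₀] [Fintype ι₁] [DecidableEq ι₀] [DecidableEq ι₁]
  {p q : Submodule K (Matrix (ι₀ ⊕ ι₁) (ι₀ ⊕ ι₁) K)}

lemma superDerived_mono_s16 (h : p ≤ q) : superDerived K p ≤ superDerived K q := by
  refine Submodule.span_mono (Set.union_subset_union ?_ ?_)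
  · rintro _ ⟨x, hx, y, hy, rfl⟩
    exact ⟨x, h hx, y, h hy, rfl⟩
  · rintro _ ⟨l, hl, rfl⟩
    exact ⟨l, ⟨h hl.1, hl.2⟩, rfl⟩

lemma bracket_mem_superDerived {x y : Matrix (ι₀ ⊕ ι₁) (ι₀ ⊕ ι₁) K} (hx : x ∈ p) (hy : y ∈ p) :
    x * y - y * x ∈ superDerived K p :=
  Submodule.subset_span (Or.inl ⟨x, hx, y, hy, rfl⟩)

lemma superDerived_le (h₁ : ∀ x ∈ p, ∀ y ∈ p, x * y - y * x ∈ q)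
    (h₂ : ∀ l ∈ p, l ∈ oddPart K ι₀ ι₁ → l * l ∈ q) : superDerived K p ≤ q := by
  refine Submodule.span_le.2 (Set.union_subset ?_ ?_)
  · rintro _ ⟨x, hx, y, hy, rfl⟩
    exact h₁ x hx y hy
  · rintro _ ⟨l, hl, rfl⟩
    exact h₂ l hl.1 hl.2

end SuperDerived

section HalfTrace

variable {K α β : Type*} [Field K]

/-- The involution of the index set underlying the form `diag(Π, Π)`. -/
def blockSwap (α β : Type*) : (α ⊕ α) ⊕ (β ⊕ β) → (α ⊕ α) ⊕ (β ⊕ β) :=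
  Sum.map Sum.swap Sum.swap

lemma blockSwap_involutive : Function.Involutive (blockSwap α β) := by
  rintro ((_ | _) | (_ | _)) <;> rfl

lemma blockSwap_ne (i : (α ⊕ α) ⊕ (β ⊕ β)) : blockSwap α β i ≠ i := by
  rcases i with ((_ | _) | (_ | _)) <;> simp [blockSwap]

variable [Fintype α] [Fintype β]

/-- The half-supertrace of a matrix. -/
def halfTrace (K α β : Type*) [Field K] [Fintype α] [Fintype β] :
    Matrix ((α ⊕ α) ⊕ (β ⊕ β)) ((α ⊕ α) ⊕ (β ⊕ β)) K →ₗ[K] K where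
  toFun X := ∑ i : α, X (.inl (.inl i)) (.inl (.inl i)) +
    ∑ i : β, X (.inr (.inl i)) (.inr (.inl i))
  map_add' X Y := by
    simp only [Matrix.add_apply, Finset.sum_add_distrib]
    abel
  map_smul' c X := by simp [Finset.mul_sum, mul_add]

lemma halfTrace_apply (X : Matrix ((α ⊕ α) ⊕ (β ⊕ β)) ((α ⊕ α) ⊕ (β ⊕ β)) K) :
    halfTrace K α β X = ∑ i : α, X (.inl (.inl i)) (.inl (.inl i)) +
      ∑ i : β, X (.inr (.inl i)) (.inr (.inl i)) := rfl

lemma halfTrace_bracket [CharP K 2]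
    {X Y : Matrix ((α ⊕ α) ⊕ (β ⊕ β)) ((α ⊕ α) ⊕ (β ⊕ β)) K}
    (hX : X ∈ tauAlt K (blockSwap α β)) (hY : Y ∈ tauSymm K (blockSwap α β)) :
    halfTrace K α β (X * Y - Y * X) = 0 := by
  have h := sum_mul_apply_self blockSwap_involutive hX hY
  have h' := fun i => mul_apply_tau blockSwap_involutive hX.1 hY i i
  simp only [Fintype.sum_sum_type] at h
  rw [halfTrace_apply]
  simp only [Matrix.sub_apply, ← h', CharTwo.sub_eq_add, Finset.sum_add_distrib]
  simp only [blockSwap, Sum.map_inl, Sum.map_inr, Sum.swap_inl]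
  exact h

lemma halfTrace_mul_self [CharP K 2]
    {X : Matrix ((α ⊕ α) ⊕ (β ⊕ β)) ((α ⊕ α) ⊕ (β ⊕ β)) K}
    (hX : X ∈ tauSymm K (blockSwap α β)) (hodd : X ∈ oddPart K (α ⊕ α) (β ⊕ β)) :
    halfTrace K α β (X * X) = 0 := by
  obtain ⟨h0, h1⟩ := hodd
  simp only [halfTrace_apply, Matrix.mul_apply, Fintype.sum_sum_type, h0, h1, zero_mul,
    Finset.sum_const_zero, zero_add, add_zero, Finset.sum_add_distrib]
  rw [Finset.sum_comm (s := (Finset.univ : Finset β)) (t := (Finset.univ : Finset α)),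
    Finset.sum_comm (s := (Finset.univ : Finset β)) (t := (Finset.univ : Finset α))]
  have e₁ : ∀ (i : α) (j : β), X (.inr (.inl j)) (.inl (.inr i)) =
      X (.inl (.inl i)) (.inr (.inr j)) := fun i j => hX (.inl (.inl i)) (.inr (.inr j))
  have e₂ : ∀ (i : α) (j : β), X (.inl (.inr i)) (.inr (.inl j)) =
      X (.inr (.inr j)) (.inl (.inl i)) := fun i j => hX (.inr (.inr j)) (.inl (.inl i))
  simp only [e₁, e₂, mul_comm (X (.inr (.inl _)) (.inl (.inl _)))]
  exact CharTwo.add_self_eq_zero _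

lemma halfTrace_tauUnit [DecidableEq α] [DecidableEq β] {i j : (α ⊕ α) ⊕ (β ⊕ β)}
    (h : j ≠ blockSwap α β i) : halfTrace K α β (tauUnit K (blockSwap α β) i j) = 0 := by
  have key : ∀ a, tauUnit K (blockSwap α β) i j a a = 0 := fun a => by
    have h₁ : ¬ (blockSwap α β i = a ∧ j = a) := by rintro ⟨rfl, rfl⟩; exact h rfl
    have h₂ : ¬ (blockSwap α β j = a ∧ i = a) := by
      rintro ⟨rfl, rfl⟩; exact h (blockSwap_involutive j).symm
    simp [tauUnit, h₁, h₂]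
  simp [halfTrace_apply, key]

lemma halfTrace_tauUnit_inl [DecidableEq α] [DecidableEq β] (i : α) :
    halfTrace K α β (tauUnit K (blockSwap α β) (.inl (.inl i)) (.inl (.inr i))) = 1 := by
  simp [halfTrace_apply, tauUnit, single_apply, blockSwap]

/-- Elements of `tauAlt` with vanishing half-supertrace. -/
def tauAltHalf (K α β : Type*) [Field K] [Fintype α] [Fintype β] :
    Submodule K (Matrix ((α ⊕ α) ⊕ (β ⊕ β)) ((α ⊕ α) ⊕ (β ⊕ β)) K) :=
  tauAlt K (blockSwap α β) ⊓ LinearMap.ker (halfTrace K α β)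

variable [DecidableEq α] [DecidableEq β]

lemma tauUnit_mem_tauAltHalf {i j : (α ⊕ α) ⊕ (β ⊕ β)} (h : i ≠ j) (h' : j ≠ blockSwap α β i) :
    tauUnit K (blockSwap α β) i j ∈ tauAltHalf K α β :=
  ⟨tauUnit_mem_tauAlt blockSwap_involutive h, halfTrace_tauUnit h'⟩

variable [CharP K 2]

lemma superDerived_tauSymm_le :
    superDerived K (tauSymm K (blockSwap α β)) ≤ tauAlt K (blockSwap α β) :=
  superDerived_le (fun _ hx _ hy => mul_sub_mul_mem_tauAlt blockSwap_involutive hx hy)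
    fun _ hl _ => mul_self_mem_tauAlt blockSwap_involutive blockSwap_ne hl

lemma superDerived_tauAlt_le :
    superDerived K (tauAlt K (blockSwap α β)) ≤ tauAltHalf K α β :=
  superDerived_le
    (fun _ hx _ hy => ⟨mul_sub_mul_mem_tauAlt blockSwap_involutive hx.1 hy.1,
      halfTrace_bracket hx hy.1⟩)
    fun _ hl ho => ⟨mul_self_mem_tauAlt blockSwap_involutive blockSwap_ne hl.1,
      halfTrace_mul_self hl.1 ho⟩

lemma tauUnit_mem_superDerived (hc : 4 < Fintype.card ((α ⊕ α) ⊕ (β ⊕ β)))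
    {i k : (α ⊕ α) ⊕ (β ⊕ β)} (h' : k ≠ blockSwap α β i) :
    tauUnit K (blockSwap α β) i k ∈ superDerived K (tauAltHalf K α β) := by
  have hinv := blockSwap_involutive (α := α) (β := β)
  obtain ⟨j, -, hj⟩ : ∃ j ∈ Finset.univ, j ∉
      ({i, k, blockSwap α β i, blockSwap α β k} : Finset _) :=
    Finset.exists_mem_notMem_of_card_lt_card (Finset.card_le_four.trans_lt hc)
  simp only [Finset.mem_insert, Finset.mem_singleton, not_or] at hj
  obtain ⟨hji, hjk, hji', hjk'⟩ := hj
  have hne : blockSwap α β j ≠ k := fun e => hjk' (by rw [← e, hinv])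
  rw [← tauUnit_bracket hinv (Ne.symm hji) h'.symm hne]
  exact bracket_mem_superDerived (tauUnit_mem_tauAltHalf (Ne.symm hji) hji')
    (tauUnit_mem_tauAltHalf hne (by rw [hinv]; exact Ne.symm hjk))

lemma tauUnit_add_mem_superDerived {i j : (α ⊕ α) ⊕ (β ⊕ β)} (h : i ≠ j)
    (h' : j ≠ blockSwap α β i) :
    tauUnit K (blockSwap α β) i (blockSwap α β i) + tauUnit K (blockSwap α β) j (blockSwap α β j) ∈
      superDerived K (tauAltHalf K α β) := by
  have hinv := blockSwap_involutive (α := α) (β := β)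
  rw [← tauUnit_bracket_tau hinv h]
  exact bracket_mem_superDerived (tauUnit_mem_tauAltHalf h h')
    (tauUnit_mem_tauAltHalf (hinv.injective.ne h.symm) (by rw [hinv]; exact h'.symm))

lemma superDerived_tauAltHalf [Nonempty α] (hc : 4 < Fintype.card ((α ⊕ α) ⊕ (β ⊕ β))) :
    superDerived K (tauAltHalf K α β) = tauAltHalf K α β := by
  have hinv := blockSwap_involutive (α := α) (β := β)
  have hle := (superDerived_mono_s16 (K := K) (inf_le_left : tauAltHalf K α β ≤ _)).trans
    superDerived_tauAlt_le
  refine le_antisymm hle fun X hX => ?_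
  obtain ⟨a⟩ := ‹Nonempty α›
  set i₀ : (α ⊕ α) ⊕ (β ⊕ β) := .inl (.inl a)
  have hXq : X ∈ superDerived K (tauAltHalf K α β) ⊔
      Submodule.span K {tauUnit K (blockSwap α β) i₀ (blockSwap α β i₀)} := by
    refine mem_of_tauUnit_mem hinv (fun i j hij => ?_) hX.1
    have hmem : tauUnit K (blockSwap α β) i₀ (blockSwap α β i₀) ∈
        superDerived K (tauAltHalf K α β) ⊔
          Submodule.span K {tauUnit K (blockSwap α β) i₀ (blockSwap α β i₀)} :=
      Submodule.mem_sup_right (Submodule.mem_span_singleton_self _)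
    by_cases hj : j = blockSwap α β i
    · subst hj
      by_cases h₁ : i₀ = i
      · rwa [← h₁]
      by_cases h₂ : i = blockSwap α β i₀
      · have he : tauUnit K (blockSwap α β) i (blockSwap α β i) =
            tauUnit K (blockSwap α β) i₀ (blockSwap α β i₀) := by rw [h₂, hinv, tauUnit_comm]
        exact he ▸ hmem
      have := Submodule.mem_sup_left (T := Submodule.span K
        {tauUnit K (blockSwap α β) i₀ (blockSwap α β i₀)})
        (tauUnit_add_mem_superDerived (K := K) h₁ h₂)
      exact (Submodule.add_mem_iff_right _ hmem).1 this
    · exact Submodule.mem_sup_left (tauUnit_mem_superDerived hc hj)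
  obtain ⟨Y, hY, Z, hZ, rfl⟩ := Submodule.mem_sup.1 hXq
  obtain ⟨c, rfl⟩ := Submodule.mem_span_singleton.1 hZ
  have hX0 : halfTrace K α β _ = 0 := hX.2
  have hY0 : halfTrace K α β Y = 0 := (hle hY).2
  have h₁ := halfTrace_tauUnit_inl (K := K) (β := β) a
  have hc0 : c = 0 := by
    rw [map_add, hY0, map_smul, zero_add] at hX0
    have h₂ : c • (1 : K) = 0 := h₁ ▸ hX0
    simpa using h₂
  simpa [hc0] using hY

lemma superDerived_tauAlt [Nonempty α] (hc : 4 < Fintype.card ((α ⊕ α) ⊕ (β ⊕ β))) :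
    superDerived K (tauAlt K (blockSwap α β)) = tauAltHalf K α β :=
  le_antisymm superDerived_tauAlt_le
    ((superDerived_tauAltHalf hc).ge.trans (superDerived_mono_s16 inf_le_left))

lemma superDerived_tauSymm [Nonempty α] (hc : 4 < Fintype.card ((α ⊕ α) ⊕ (β ⊕ β))) :
    superDerived K (tauSymm K (blockSwap α β)) = tauAlt K (blockSwap α β) := by
  have hinv := blockSwap_involutive (α := α) (β := β)
  refine le_antisymm superDerived_tauSymm_le fun X hX => ?_
  have hle : tauAltHalf K α β ≤ superDerived K (tauSymm K (blockSwap α β)) :=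
    (superDerived_tauAlt hc).ge.trans (superDerived_mono_s16 fun _ h => h.1)
  refine mem_of_tauUnit_mem hinv (fun i j hij => ?_) hX
  by_cases hj : j = blockSwap α β i
  · rw [hj, ← single_bracket_tau hinv]
    exact bracket_mem_superDerived (single_mem_tauSymm hinv _) (single_mem_tauSymm hinv _)
  · exact hle (tauUnit_mem_tauAltHalf hij hj)

end HalfTrace

section OoPiPi

variable {K : Type*} [Field K] {k₀ k₁ : ℕ}

lemma PiB_mul_apply {m : Type*} {k : ℕ} (M : Matrix (Fin k ⊕ Fin k) m K) (i : Fin k ⊕ Fin k)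
    (j : m) : (PiB K k * M) i j = M i.swap j := by
  rcases i with i | i <;> simp [PiB, Matrix.mul_apply, Matrix.one_apply]

lemma mul_PiB_apply {m : Type*} {k : ℕ} (M : Matrix m (Fin k ⊕ Fin k) K) (i : m)
    (j : Fin k ⊕ Fin k) : (M * PiB K k) i j = M i j.swap := by
  rcases j with j | j <;> simp [PiB, Matrix.mul_apply, Matrix.one_apply]

lemma fromBlocks_mem_tauSymm {A₀ : Matrix (Fin k₀ ⊕ Fin k₀) (Fin k₀ ⊕ Fin k₀) K}
    {A₁ : Matrix (Fin k₁ ⊕ Fin k₁) (Fin k₁ ⊕ Fin k₁) K}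
    (C : Matrix (Fin k₁ ⊕ Fin k₁) (Fin k₀ ⊕ Fin k₀) K) (h₀ : A₀.IsSymm) (h₁ : A₁.IsSymm) :
    fromBlocks (PiB K k₀ * A₀) (PiB K k₀ * Cᵀ * PiB K k₁) C (PiB K k₁ * A₁) ∈
      tauSymm K (blockSwap (Fin k₀) (Fin k₁)) := by
  rintro (i | i) (j | j) <;>
    simp [blockSwap, PiB_mul_apply, mul_PiB_apply, h₀.apply, h₁.apply]

lemma exists_fromBlocks_of_mem_tauSymm
    {X : Matrix ((Fin k₀ ⊕ Fin k₀) ⊕ (Fin k₁ ⊕ Fin k₁)) ((Fin k₀ ⊕ Fin k₀) ⊕ (Fin k₁ ⊕ Fin k₁)) K}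
    (hX : X ∈ tauSymm K (blockSwap (Fin k₀) (Fin k₁))) :
    ∃ (A₀ : Matrix (Fin k₀ ⊕ Fin k₀) (Fin k₀ ⊕ Fin k₀) K)
      (A₁ : Matrix (Fin k₁ ⊕ Fin k₁) (Fin k₁ ⊕ Fin k₁) K)
      (C : Matrix (Fin k₁ ⊕ Fin k₁) (Fin k₀ ⊕ Fin k₀) K), A₀.IsSymm ∧ A₁.IsSymm ∧
    X = fromBlocks (PiB K k₀ * A₀) (PiB K k₀ * Cᵀ * PiB K k₁) C (PiB K k₁ * A₁) := by
  refine ⟨PiB K k₀ * X.toBlocks₁₁, PiB K k₁ * X.toBlocks₂₂, X.toBlocks₂₁,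
    Matrix.IsSymm.ext fun i j => ?_, Matrix.IsSymm.ext fun i j => ?_, ?_⟩
  · simpa [PiB_mul_apply, blockSwap, toBlocks₁₁] using hX (.inl i.swap) (.inl j)
  · simpa [PiB_mul_apply, blockSwap, toBlocks₂₂] using hX (.inr i.swap) (.inr j)
  · ext (i | i) (j | j)
    · simp [PiB_mul_apply, toBlocks₁₁]
    · simpa [PiB_mul_apply, mul_PiB_apply, toBlocks₂₁, blockSwap] using (hX (.inl i) (.inr j)).symm
    · simp [toBlocks₂₁]
    · simp [PiB_mul_apply, toBlocks₂₂]

lemma fromBlocks_mem_tauAlt_iff {A₀ : Matrix (Fin k₀ ⊕ Fin k₀) (Fin k₀ ⊕ Fin k₀) K}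
    {A₁ : Matrix (Fin k₁ ⊕ Fin k₁) (Fin k₁ ⊕ Fin k₁) K}
    (C : Matrix (Fin k₁ ⊕ Fin k₁) (Fin k₀ ⊕ Fin k₀) K) (h₀ : A₀.IsSymm) (h₁ : A₁.IsSymm) :
    fromBlocks (PiB K k₀ * A₀) (PiB K k₀ * Cᵀ * PiB K k₁) C (PiB K k₁ * A₁) ∈
      tauAlt K (blockSwap (Fin k₀) (Fin k₁)) ↔ (∀ i, A₀ i i = 0) ∧ ∀ i, A₁ i i = 0 := by
  have : fromBlocks (PiB K k₀ * A₀) (PiB K k₀ * Cᵀ * PiB K k₁) C (PiB K k₁ * A₁) ∈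
      tauAlt K (blockSwap (Fin k₀) (Fin k₁)) ↔ _ ∧ _ := Iff.rfl
  rw [this, and_iff_right (fromBlocks_mem_tauSymm C h₀ h₁), Sum.forall]
  simp only [blockSwap, Sum.map_inl, Sum.map_inr, fromBlocks_apply₁₁, fromBlocks_apply₂₂,
    PiB_mul_apply]
  simp only [Sum.forall, Sum.swap_inl, Sum.swap_inr, and_comm]

lemma ooPiPi_eq_tauSymm : ooPiPi K k₀ k₁ = tauSymm K (blockSwap (Fin k₀) (Fin k₁)) := by
  ext X
  constructor
  · rintro ⟨A₀, A₁, C, h₀, h₁, rfl⟩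
    exact fromBlocks_mem_tauSymm C h₀ h₁
  · exact exists_fromBlocks_of_mem_tauSymm

end OoPiPi

/-- For `n₀ = 2k₀ ≥ 2`, `n₁ = 2k₁ ≥ 2` and `n₀ + n₁ ≥ 6`:
(i) the derived superalgebra of `g = oo_{ΠΠ}(n₀|n₁)` consists of its elements with `A₀, A₁`
zero-diagonal; (ii) the second derived superalgebra consists of the elements of `D(g)` whose
"half-supertrace" `Σ_{i<k₀}(Π_{n₀}A₀)_{ii} + Σ_{i<k₁}(Π_{n₁}A₁)_{ii}` vanishes;
(iii) the third derived superalgebra equals the second. -/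
theorem derived_ooPiPi
    (K : Type*) [Field K] [IsAlgClosed K] [CharP K 2] (k₀ k₁ : ℕ)
    (h0 : 1 ≤ k₀) (h1 : 1 ≤ k₁) (h : 6 ≤ 2 * k₀ + 2 * k₁) :
    ((superDerived K (ooPiPi K k₀ k₁) :
        Set (Matrix ((Fin k₀ ⊕ Fin k₀) ⊕ (Fin k₁ ⊕ Fin k₁))
          ((Fin k₀ ⊕ Fin k₀) ⊕ (Fin k₁ ⊕ Fin k₁)) K)) =
      {X | ∃ (A₀ : Matrix (Fin k₀ ⊕ Fin k₀) (Fin k₀ ⊕ Fin k₀) K)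
          (A₁ : Matrix (Fin k₁ ⊕ Fin k₁) (Fin k₁ ⊕ Fin k₁) K)
          (C : Matrix (Fin k₁ ⊕ Fin k₁) (Fin k₀ ⊕ Fin k₀) K),
        A₀.IsSymm ∧ (∀ i, A₀ i i = 0) ∧ A₁.IsSymm ∧ (∀ i, A₁ i i = 0) ∧
        X = Matrix.fromBlocks (PiB K k₀ * A₀) (PiB K k₀ * Cᵀ * PiB K k₁) C
          (PiB K k₁ * A₁)}) ∧
    ((superDerived K (superDerived K (ooPiPi K k₀ k₁)) :
        Set (Matrix ((Fin k₀ ⊕ Fin k₀) ⊕ (Fin k₁ ⊕ Fin k₁))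
          ((Fin k₀ ⊕ Fin k₀) ⊕ (Fin k₁ ⊕ Fin k₁)) K)) =
      {X | ∃ (A₀ : Matrix (Fin k₀ ⊕ Fin k₀) (Fin k₀ ⊕ Fin k₀) K)
          (A₁ : Matrix (Fin k₁ ⊕ Fin k₁) (Fin k₁ ⊕ Fin k₁) K)
          (C : Matrix (Fin k₁ ⊕ Fin k₁) (Fin k₀ ⊕ Fin k₀) K),
        A₀.IsSymm ∧ (∀ i, A₀ i i = 0) ∧ A₁.IsSymm ∧ (∀ i, A₁ i i = 0) ∧
        (∑ i : Fin k₀, (PiB K k₀ * A₀) (Sum.inl i) (Sum.inl i)) +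
          (∑ i : Fin k₁, (PiB K k₁ * A₁) (Sum.inl i) (Sum.inl i)) = 0 ∧
        X = Matrix.fromBlocks (PiB K k₀ * A₀) (PiB K k₀ * Cᵀ * PiB K k₁) C
          (PiB K k₁ * A₁)}) ∧
    superDerived K (superDerived K (superDerived K (ooPiPi K k₀ k₁))) =
      superDerived K (superDerived K (ooPiPi K k₀ k₁)) := by
  have : Nonempty (Fin k₀) := ⟨⟨0, h0⟩⟩
  have hc : 4 < Fintype.card ((Fin k₀ ⊕ Fin k₀) ⊕ (Fin k₁ ⊕ Fin k₁)) := by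
    simp only [Fintype.card_sum, Fintype.card_fin]
    omega
  rw [ooPiPi_eq_tauSymm, superDerived_tauSymm hc, superDerived_tauAlt hc,
    superDerived_tauAltHalf hc]
  refine ⟨?_, ?_, rfl⟩
  · ext X
    constructor
    · intro hX
      obtain ⟨A₀, A₁, C, h₀, h₁, rfl⟩ := exists_fromBlocks_of_mem_tauSymm hX.1
      obtain ⟨d₀, d₁⟩ := (fromBlocks_mem_tauAlt_iff C h₀ h₁).1 hX
      exact ⟨A₀, A₁, C, h₀, d₀, h₁, d₁, rfl⟩
    · rintro ⟨A₀, A₁, C, h₀, d₀, h₁, d₁, rfl⟩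
      exact (fromBlocks_mem_tauAlt_iff C h₀ h₁).2 ⟨d₀, d₁⟩
  · ext X
    constructor
    · intro hX
      obtain ⟨A₀, A₁, C, h₀, h₁, rfl⟩ := exists_fromBlocks_of_mem_tauSymm hX.1.1
      obtain ⟨d₀, d₁⟩ := (fromBlocks_mem_tauAlt_iff C h₀ h₁).1 hX.1
      exact ⟨A₀, A₁, C, h₀, d₀, h₁, d₁, hX.2, rfl⟩
    · rintro ⟨A₀, A₁, C, h₀, d₀, h₁, d₁, ht, rfl⟩
      exact ⟨(fromBlocks_mem_tauAlt_iff C h₀ h₁).2 ⟨d₀, d₁⟩, ht⟩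
end

section
/- Let K be an algebraically closed field of characteristic 2 and k ≥ 3. Let pe(k) ⊂ gl(2k, K) consist of all block matrices [[A, C],[D, Aᵀ]] with A ∈ gl(k,K) and C, D symmetric k×k matrices; its even part consists of those elements with C = D = 0 and its odd part of those with A = 0. Then: (i) D(pe(k)) = {elements of pe(k) with C and D zero-diagonal}; (ii) D²(pe(k)) = {elements of D(pe(k)) with tr A = 0}; (iii) D³(pe(k)) = D²(pe(k)). -/
open Matrix

/-- The periplectic Lie superalgebra `pe(k)` in characteristic 2: block matrices
`[[A,C],[D,Aᵀ]]` with `A` arbitrary and `C, D` symmetric; the even part has `C = D = 0`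
and the odd part has `A = 0`. -/
def peAlg (K : Type*) [Field K] (k : ℕ) :
    Submodule K (Matrix (Fin k ⊕ Fin k) (Fin k ⊕ Fin k) K) where
  carrier := {X | ∃ A C D : Matrix (Fin k) (Fin k) K, C.IsSymm ∧ D.IsSymm ∧
    X = Matrix.fromBlocks A C D Aᵀ}
  add_mem' := by
    rintro a b ⟨A1, C1, D1, hC1, hD1, rfl⟩ ⟨A2, C2, D2, hC2, hD2, rfl⟩
    exact ⟨A1 + A2, C1 + C2, D1 + D2, hC1.add hC2, hD1.add hD2,
      by rw [Matrix.fromBlocks_add, Matrix.transpose_add]⟩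
  zero_mem' := ⟨0, 0, 0, isSymm_zero, isSymm_zero, by simp⟩
  smul_mem' := by
    rintro c a ⟨A1, C1, D1, hC1, hD1, rfl⟩
    exact ⟨c • A1, c • C1, c • D1, hC1.smul c, hD1.smul c,
      by rw [Matrix.fromBlocks_smul, Matrix.transpose_smul]⟩

namespace Periplectic

variable {K : Type*} [Field K]

theorem charTwo_neg_eq [CharP K 2] {m n : Type*} (A : Matrix m n K) : -A = A := by
  ext i j
  exact CharTwo.neg_eq _

/-- The embedding of `gl(n)` as the even part of the periplectic superalgebra. -/
def evenBlock (K n : Type*) [Field K] : Matrix n n K →ₗ[K] Matrix (n ⊕ n) (n ⊕ n) K where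
  toFun A := fromBlocks A 0 0 Aᵀ
  map_add' A B := by simp [fromBlocks_add]
  map_smul' c A := by simp [fromBlocks_smul]

/-- The embedding of square matrices as upper right blocks. -/
def upperBlock (K n : Type*) [Field K] : Matrix n n K →ₗ[K] Matrix (n ⊕ n) (n ⊕ n) K where
  toFun C := fromBlocks 0 C 0 0
  map_add' A B := by simp [fromBlocks_add]
  map_smul' c A := by simp [fromBlocks_smul]

/-- The embedding of square matrices as lower left blocks. -/
def lowerBlock (K n : Type*) [Field K] : Matrix n n K →ₗ[K] Matrix (n ⊕ n) (n ⊕ n) K where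
  toFun D := fromBlocks 0 0 D 0
  map_add' A B := by simp [fromBlocks_add]
  map_smul' c A := by simp [fromBlocks_smul]

@[simp]
theorem evenBlock_apply {n : Type*} (A : Matrix n n K) :
    evenBlock K n A = fromBlocks A 0 0 Aᵀ :=
  rfl

@[simp]
theorem upperBlock_apply {n : Type*} (C : Matrix n n K) :
    upperBlock K n C = fromBlocks 0 C 0 0 :=
  rfl

@[simp]
theorem lowerBlock_apply {n : Type*} (D : Matrix n n K) :
    lowerBlock K n D = fromBlocks 0 0 D 0 :=
  rfl

theorem fromBlocks_eq_add {n : Type*} (A C D : Matrix n n K) :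
    fromBlocks A C D Aᵀ = evenBlock K n A + upperBlock K n C + lowerBlock K n D := by
  simp [fromBlocks_add]

/-- The symmetric matrices with zero diagonal. -/
def zeroDiagSymm (K n : Type*) [Field K] : Submodule K (Matrix n n K) where
  carrier := {C | C.IsSymm ∧ ∀ i, C i i = 0}
  add_mem' := by
    rintro A B ⟨hA, hA'⟩ ⟨hB, hB'⟩
    exact ⟨hA.add hB, fun i => by simp [hA' i, hB' i]⟩
  zero_mem' := ⟨isSymm_zero, fun _ => rfl⟩
  smul_mem' := by
    rintro c A ⟨hA, hA'⟩
    exact ⟨hA.smul c, fun i => by simp [hA' i]⟩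

theorem add_transpose_mem_zeroDiagSymm [CharP K 2] {n : Type*} (A : Matrix n n K) :
    A + Aᵀ ∈ zeroDiagSymm K n :=
  ⟨isSymm_add_transpose_self A, fun i => CharTwo.add_self_eq_zero (A i i)⟩

/-- The elements of the periplectic superalgebra whose odd blocks have zero diagonal. -/
def zeroDiagPe (K n : Type*) [Field K] : Submodule K (Matrix (n ⊕ n) (n ⊕ n) K) :=
  LinearMap.range (evenBlock K n) ⊔ (zeroDiagSymm K n).map (upperBlock K n) ⊔
    (zeroDiagSymm K n).map (lowerBlock K n)

/-- The elements of `zeroDiagPe` whose even blocks have zero trace. -/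
def specialPe (K n : Type*) [Field K] [Fintype n] : Submodule K (Matrix (n ⊕ n) (n ⊕ n) K) :=
  (LinearMap.ker (traceLinearMap n K K)).map (evenBlock K n) ⊔
    (zeroDiagSymm K n).map (upperBlock K n) ⊔ (zeroDiagSymm K n).map (lowerBlock K n)

theorem mem_zeroDiagPe {n : Type*} {X : Matrix (n ⊕ n) (n ⊕ n) K} :
    X ∈ zeroDiagPe K n ↔ ∃ A, ∃ C ∈ zeroDiagSymm K n, ∃ D ∈ zeroDiagSymm K n,
      X = fromBlocks A C D Aᵀ := by
  simp only [zeroDiagPe, Submodule.mem_sup, LinearMap.mem_range, Submodule.mem_map,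
    fromBlocks_eq_add]
  constructor
  · rintro ⟨_, ⟨_, ⟨A, rfl⟩, _, ⟨C, hC, rfl⟩, rfl⟩, _, ⟨D, hD, rfl⟩, rfl⟩
    exact ⟨A, C, hC, D, hD, rfl⟩
  · rintro ⟨A, C, hC, D, hD, rfl⟩
    exact ⟨_, ⟨_, ⟨A, rfl⟩, _, ⟨C, hC, rfl⟩, rfl⟩, _, ⟨D, hD, rfl⟩, rfl⟩

theorem mem_specialPe {n : Type*} [Fintype n] {X : Matrix (n ⊕ n) (n ⊕ n) K} :
    X ∈ specialPe K n ↔ ∃ A, A.trace = 0 ∧ ∃ C ∈ zeroDiagSymm K n, ∃ D ∈ zeroDiagSymm K n,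
      X = fromBlocks A C D Aᵀ := by
  simp only [specialPe, Submodule.mem_sup, LinearMap.mem_ker, Submodule.mem_map,
    fromBlocks_eq_add, traceLinearMap_apply]
  constructor
  · rintro ⟨_, ⟨_, ⟨A, hA, rfl⟩, _, ⟨C, hC, rfl⟩, rfl⟩, _, ⟨D, hD, rfl⟩, rfl⟩
    exact ⟨A, hA, C, hC, D, hD, rfl⟩
  · rintro ⟨A, hA, C, hC, D, hD, rfl⟩
    exact ⟨_, ⟨_, ⟨A, hA, rfl⟩, _, ⟨C, hC, rfl⟩, rfl⟩, _, ⟨D, hD, rfl⟩, rfl⟩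

theorem mul_self_fromBlocks {n : Type*} [Fintype n] {C D : Matrix n n K} (hC : C.IsSymm) (hD : D.IsSymm) :
    fromBlocks 0 C D 0 * fromBlocks 0 C D 0 = fromBlocks (C * D) 0 0 (C * D)ᵀ := by
  simp [fromBlocks_multiply, hC.eq, hD.eq]

section Products

variable [CharP K 2] {n : Type*} [Fintype n]

theorem commutator_fromBlocks {A C D A' C' D' : Matrix n n K}
    (hC : C.IsSymm) (hD : D.IsSymm) (hC' : C'.IsSymm) (hD' : D'.IsSymm) :
    fromBlocks A C D Aᵀ * fromBlocks A' C' D' A'ᵀ - fromBlocks A' C' D' A'ᵀ * fromBlocks A C D Aᵀ =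
      fromBlocks (A * A' - A' * A + (C * D' + C' * D))
        (A * C' + (A * C')ᵀ + (A' * C + (A' * C)ᵀ)) (D * A' + (D * A')ᵀ + (D' * A + (D' * A)ᵀ))
        (A * A' - A' * A + (C * D' + C' * D))ᵀ := by
  simp only [sub_eq_add_neg, fromBlocks_multiply, charTwo_neg_eq, fromBlocks_add,
    transpose_add, transpose_mul, hC.eq, hD.eq, hC'.eq, hD'.eq]
  congr 1 <;> abel

theorem trace_mul_eq_zero {C D : Matrix n n K} (hC : C ∈ zeroDiagSymm K n)
    (hD : D ∈ zeroDiagSymm K n) : (C * D).trace = 0 := by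
  classical
  simp only [trace, diag_apply, mul_apply]
  rw [← Finset.sum_product']
  refine Finset.sum_involution (fun x _ => x.swap) ?_ ?_ (by simp) (by simp)
  · rintro ⟨i, j⟩ -
    simp only [Prod.swap_prod_mk]
    rw [hC.1.apply i j, hD.1.apply i j, CharTwo.add_self_eq_zero]
  · rintro ⟨i, j⟩ - h h'
    obtain rfl : j = i := congrArg Prod.fst h'
    exact h (by simp [hC.2 j])

end Products

theorem eq_zero_of_fromBlocks_mem_oddPart {n : Type*} {A C D : Matrix n n K}
    (h : fromBlocks A C D Aᵀ ∈ oddPart K n n) : A = 0 := by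
  ext i j
  exact h.1 i j

theorem specialPe_le_zeroDiagPe {n : Type*} [Fintype n] : specialPe K n ≤ zeroDiagPe K n :=
  sup_le_sup_right (sup_le_sup_right LinearMap.map_le_range _) _

theorem single_add_single_mem_zeroDiagSymm {n : Type*} [DecidableEq n] {i j : n} (hij : i ≠ j) :
    single i j (1 : K) + single j i 1 ∈ zeroDiagSymm K n :=
  ⟨by simp [IsSymm, add_comm], fun a => by
    have h : ∀ {i j : n}, i ≠ j → single i j (1 : K) a a = 0 := fun h =>
      single_apply_of_ne _ _ _ _ _ fun h' => h (h'.1.trans h'.2.symm)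
    simp [h hij, h hij.symm]⟩

section Derived

variable {n : Type*} [Fintype n] [DecidableEq n]

theorem commutator_mem_superDerived {p : Submodule K (Matrix (n ⊕ n) (n ⊕ n) K)}
    {x y : Matrix (n ⊕ n) (n ⊕ n) K} (hx : x ∈ p) (hy : y ∈ p) :
    x * y - y * x ∈ superDerived K p :=
  Submodule.subset_span (Or.inl ⟨x, hx, y, hy, rfl⟩)

theorem superDerived_le_zeroDiagPe [CharP K 2] {p : Submodule K (Matrix (n ⊕ n) (n ⊕ n) K)}
    (hp : ∀ X ∈ p, ∃ A C D : Matrix n n K, C.IsSymm ∧ D.IsSymm ∧ X = fromBlocks A C D Aᵀ) :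
    superDerived K p ≤ zeroDiagPe K n := by
  refine Submodule.span_le.2 ?_
  rintro _ (⟨x, hx, y, hy, rfl⟩ | ⟨l, ⟨hl, hl'⟩, rfl⟩)
  · obtain ⟨A, C, D, hC, hD, rfl⟩ := hp x hx
    obtain ⟨A', C', D', hC', hD', rfl⟩ := hp y hy
    rw [commutator_fromBlocks hC hD hC' hD']
    exact mem_zeroDiagPe.2 ⟨_, _,
      add_mem (add_transpose_mem_zeroDiagSymm _) (add_transpose_mem_zeroDiagSymm _), _,
      add_mem (add_transpose_mem_zeroDiagSymm _) (add_transpose_mem_zeroDiagSymm _), rfl⟩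
  · obtain ⟨A, C, D, hC, hD, rfl⟩ := hp l hl
    obtain rfl := eq_zero_of_fromBlocks_mem_oddPart hl'
    rw [transpose_zero, mul_self_fromBlocks hC hD]
    exact mem_zeroDiagPe.2 ⟨_, 0, zero_mem _, 0, zero_mem _, rfl⟩

theorem superDerived_le_specialPe [CharP K 2] {p : Submodule K (Matrix (n ⊕ n) (n ⊕ n) K)}
    (hp : p ≤ zeroDiagPe K n) : superDerived K p ≤ specialPe K n := by
  refine Submodule.span_le.2 ?_
  rintro _ (⟨x, hx, y, hy, rfl⟩ | ⟨l, ⟨hl, hl'⟩, rfl⟩)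
  · obtain ⟨A, C, hC, D, hD, rfl⟩ := mem_zeroDiagPe.1 (hp hx)
    obtain ⟨A', C', hC', D', hD', rfl⟩ := mem_zeroDiagPe.1 (hp hy)
    rw [commutator_fromBlocks hC.1 hD.1 hC'.1 hD'.1]
    refine mem_specialPe.2 ⟨_, ?_, _,
      add_mem (add_transpose_mem_zeroDiagSymm _) (add_transpose_mem_zeroDiagSymm _), _,
      add_mem (add_transpose_mem_zeroDiagSymm _) (add_transpose_mem_zeroDiagSymm _), rfl⟩
    rw [trace_add, trace_add, trace_sub, trace_mul_comm A, sub_self, trace_mul_eq_zero hC hD',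
      trace_mul_eq_zero hC' hD, add_zero, add_zero]
  · obtain ⟨A, C, hC, D, hD, rfl⟩ := mem_zeroDiagPe.1 (hp hl)
    obtain rfl := eq_zero_of_fromBlocks_mem_oddPart hl'
    rw [transpose_zero, mul_self_fromBlocks hC.1 hD.1]
    exact mem_specialPe.2 ⟨_, trace_mul_eq_zero hC hD, 0, zero_mem _, 0, zero_mem _, rfl⟩

theorem mem_of_trace_eq_zero {q : Submodule K (Matrix n n K)}
    (hoff : ∀ i j, i ≠ j → single i j (1 : K) ∈ q)
    (hdiag : ∀ i j, i ≠ j → single i i (1 : K) - single j j 1 ∈ q)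
    {A : Matrix n n K} (hA : A.trace = 0) : A ∈ q := by
  cases isEmpty_or_nonempty n
  · rw [Subsingleton.elim A 0]
    exact zero_mem q
  obtain ⟨o⟩ := ‹Nonempty n›
  have key : A = ∑ i, ∑ j, A i j • (single i j 1 - if i = j then single o o 1 else 0) := by
    simp only [smul_sub, Finset.sum_sub_distrib, smul_ite, smul_zero, Finset.sum_ite_eq,
      Finset.mem_univ, if_true, ← Finset.sum_smul]
    rw [show ∑ i, A i i = 0 from hA, zero_smul, sub_zero]
    conv_lhs => rw [matrix_eq_sum_single A]
    simp
  rw [key]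
  refine sum_mem fun i _ => sum_mem fun j _ => q.smul_mem _ ?_
  split_ifs with h
  · subst h
    by_cases ho : i = o
    · simp [ho]
    · exact hdiag i o ho
  · simpa using hoff i j h

theorem mem_of_mem_zeroDiagSymm {q : Submodule K (Matrix n n K)}
    (h : ∀ i j, i ≠ j → single i j (1 : K) + single j i 1 ∈ q)
    {C : Matrix n n K} (hC : C ∈ zeroDiagSymm K n) : C ∈ q := by
  let _ : LinearOrder n := LinearOrder.lift' _ (Fintype.equivFin n).injective
  have key : C = ∑ i, ∑ j, (if i < j then C i j else 0) • (single i j 1 + single j i 1) := by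
    have hU := matrix_eq_sum_single (of fun i j => if i < j then C i j else 0)
    have hCU : C = (of fun i j => if i < j then C i j else 0) +
        (of fun i j => if i < j then C i j else 0)ᵀ := by
      ext a b
      rcases lt_trichotomy a b with hab | rfl | hab
      · simp [hab, hab.not_gt]
      · simp [hC.2 a]
      · simp [hab, hab.not_gt, hC.1.apply]
    simp only [smul_add, smul_single, smul_eq_mul, mul_one, Finset.sum_add_distrib]
    conv_lhs => rw [hCU, hU]
    simp [transpose_sum]
  rw [key]
  refine sum_mem fun i _ => sum_mem fun j _ => ?_
  split_ifs with hij
  · exact q.smul_mem _ (h i j hij.ne)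
  · simp

theorem commutator_evenBlock [CharP K 2] (A B : Matrix n n K) :
    evenBlock K n A * evenBlock K n B - evenBlock K n B * evenBlock K n A =
      evenBlock K n (A * B - B * A) := by
  have := commutator_fromBlocks (A := A) (A' := B) (C := 0) (D := 0) (C' := 0) (D' := 0)
    isSymm_zero isSymm_zero isSymm_zero isSymm_zero
  simpa [-map_sub] using this

theorem commutator_evenBlock_upperBlock [CharP K 2] (A : Matrix n n K) {C : Matrix n n K}
    (hC : C.IsSymm) :
    evenBlock K n A * upperBlock K n C - upperBlock K n C * evenBlock K n A =
      upperBlock K n (A * C + (A * C)ᵀ) := by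
  have := commutator_fromBlocks (A := A) (A' := 0) (C := 0) (D := 0) (C' := C) (D' := 0)
    isSymm_zero isSymm_zero hC isSymm_zero
  simpa using this

theorem commutator_lowerBlock_evenBlock [CharP K 2] (A : Matrix n n K) {D : Matrix n n K}
    (hD : D.IsSymm) :
    lowerBlock K n D * evenBlock K n A - evenBlock K n A * lowerBlock K n D =
      lowerBlock K n (D * A + (D * A)ᵀ) := by
  have := commutator_fromBlocks (A := 0) (A' := A) (C := 0) (D := D) (C' := 0) (D' := 0)
    isSymm_zero hD isSymm_zero isSymm_zero
  simpa using this

theorem commutator_upperBlock_lowerBlock [CharP K 2] {C D : Matrix n n K}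
    (hC : C.IsSymm) (hD : D.IsSymm) :
    upperBlock K n C * lowerBlock K n D - lowerBlock K n D * upperBlock K n C =
      evenBlock K n (C * D) := by
  have := commutator_fromBlocks (A := 0) (A' := 0) (C := C) (D := 0) (C' := 0) (D' := D)
    hC isSymm_zero isSymm_zero hD
  simpa using this

theorem specialPe_le_superDerived [CharP K 2] (hn : 3 ≤ Fintype.card n)
    {p : Submodule K (Matrix (n ⊕ n) (n ⊕ n) K)} (hp : specialPe K n ≤ p) :
    specialPe K n ≤ superDerived K p := by
  have hE {i j : n} (h : i ≠ j) : evenBlock K n (single i j 1) ∈ p :=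
    hp <| Submodule.mem_sup_left <| Submodule.mem_sup_left <|
      Submodule.mem_map_of_mem (trace_single_eq_of_ne i j 1 h)
  have hU {i j : n} (h : i ≠ j) : upperBlock K n (single i j 1 + single j i 1) ∈ p :=
    hp <| Submodule.mem_sup_left <| Submodule.mem_sup_right <|
      Submodule.mem_map_of_mem (single_add_single_mem_zeroDiagSymm h)
  have hL {i j : n} (h : i ≠ j) : lowerBlock K n (single i j 1 + single j i 1) ∈ p :=
    hp <| Submodule.mem_sup_right <|
      Submodule.mem_map_of_mem (single_add_single_mem_zeroDiagSymm h)
  have third (i j : n) : ∃ l, l ≠ i ∧ l ≠ j := by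
    obtain ⟨l, hl⟩ := Finset.exists_mem_notMem_of_card_lt_card
      (s := {i, j}) (t := Finset.univ) (by
        rw [Finset.card_univ]
        exact Finset.card_le_two.trans_lt hn)
    exact ⟨l, by simpa using hl⟩
  refine sup_le (sup_le ?_ ?_) ?_ <;> rw [Submodule.map_le_iff_le_comap] <;> intro M hM
  · refine mem_of_trace_eq_zero (fun i j hij => ?_) (fun i j hij => ?_) hM
    · obtain ⟨l, hli, hlj⟩ := third i j
      have := commutator_mem_superDerived (hE hli.symm) (hE hlj)
      rw [commutator_evenBlock] at this
      simpa [single_mul_single_of_ne _ _ _ _ hij.symm] using this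
    · have := commutator_mem_superDerived (hE hij) (hE hij.symm)
      rw [commutator_evenBlock] at this
      simpa using this
  · refine mem_of_mem_zeroDiagSymm (fun i j hij => ?_) hM
    obtain ⟨l, hli, hlj⟩ := third i j
    have := commutator_mem_superDerived (hE hli.symm) (hU hlj)
    rw [commutator_evenBlock_upperBlock _ (single_add_single_mem_zeroDiagSymm hlj).1] at this
    simpa [mul_add, single_mul_single_of_ne _ _ _ _ hlj] using this
  · refine mem_of_mem_zeroDiagSymm (fun i j hij => ?_) hM
    obtain ⟨l, hli, hlj⟩ := third i j
    have := commutator_mem_superDerived (hL hli.symm) (hE hlj)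
    rw [commutator_lowerBlock_evenBlock _ (single_add_single_mem_zeroDiagSymm hli.symm).1] at this
    simpa [add_mul, single_mul_single_of_ne _ _ _ _ hli.symm] using this

theorem zeroDiagPe_le_superDerived [CharP K 2] (hn : 3 ≤ Fintype.card n)
    {p : Submodule K (Matrix (n ⊕ n) (n ⊕ n) K)} (hp : specialPe K n ≤ p)
    (hU : ∀ C : Matrix n n K, C.IsSymm → upperBlock K n C ∈ p)
    (hL : ∀ D : Matrix n n K, D.IsSymm → lowerBlock K n D ∈ p) :
    zeroDiagPe K n ≤ superDerived K p := by
  have hS := specialPe_le_superDerived hn hp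
  refine sup_le (sup_le ?_ ?_) ?_
  · rintro _ ⟨A, rfl⟩
    obtain ⟨o⟩ : Nonempty n := Fintype.card_pos_iff.1 (by omega)
    have hs : (single o o (1 : K)).IsSymm := by simp [IsSymm]
    have h₁ : evenBlock K n (single o o 1) ∈ superDerived K p := by
      have := commutator_mem_superDerived (hU _ hs) (hL _ hs)
      rw [commutator_upperBlock_lowerBlock hs hs] at this
      simpa using this
    have h₂ : evenBlock K n (A - A.trace • single o o 1) ∈ superDerived K p :=
      hS <| Submodule.mem_sup_left <| Submodule.mem_sup_left <|
        Submodule.mem_map_of_mem (by simp)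
    have := add_mem h₂ (Submodule.smul_mem _ A.trace h₁)
    rwa [← map_smul, ← map_add, sub_add_cancel] at this
  · exact (le_sup_right.trans le_sup_left).trans hS
  · exact le_sup_right.trans hS

end Derived

end Periplectic

open Periplectic

/-- For `k ≥ 3`: (i) the derived superalgebra of `pe(k)` consists of its elements with `C, D`
zero-diagonal; (ii) the second derived superalgebra consists of the elements of `D(pe(k))`
with `tr A = 0`; (iii) the third derived superalgebra equals the second. -/
theorem derived_pe
    (K : Type*) [Field K] [IsAlgClosed K] [CharP K 2] (k : ℕ) (hk : 3 ≤ k) :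
    ((superDerived K (peAlg K k) : Set (Matrix (Fin k ⊕ Fin k) (Fin k ⊕ Fin k) K)) =
      {X | ∃ A C D : Matrix (Fin k) (Fin k) K, C.IsSymm ∧ (∀ i, C i i = 0) ∧
        D.IsSymm ∧ (∀ i, D i i = 0) ∧ X = Matrix.fromBlocks A C D Aᵀ}) ∧
    ((superDerived K (superDerived K (peAlg K k)) :
        Set (Matrix (Fin k ⊕ Fin k) (Fin k ⊕ Fin k) K)) =
      {X | ∃ A C D : Matrix (Fin k) (Fin k) K, C.IsSymm ∧ (∀ i, C i i = 0) ∧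
        D.IsSymm ∧ (∀ i, D i i = 0) ∧ A.trace = 0 ∧ X = Matrix.fromBlocks A C D Aᵀ}) ∧
    superDerived K (superDerived K (superDerived K (peAlg K k))) =
      superDerived K (superDerived K (peAlg K k)) := by
  have hn : 3 ≤ Fintype.card (Fin k) := by simpa using hk
  have hZ : zeroDiagPe K (Fin k) ≤ peAlg K k := by
    intro X hX
    obtain ⟨A, C, hC, D, hD, rfl⟩ := mem_zeroDiagPe.1 hX
    exact ⟨A, C, D, hC.1, hD.1, rfl⟩
  have h₁ : superDerived K (peAlg K k) = zeroDiagPe K (Fin k) :=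
    le_antisymm (superDerived_le_zeroDiagPe fun _ hX => hX) <|
      zeroDiagPe_le_superDerived hn (specialPe_le_zeroDiagPe.trans hZ)
        (fun C hC => ⟨0, C, 0, hC, isSymm_zero, by simp⟩)
        (fun D hD => ⟨0, 0, D, isSymm_zero, hD, by simp⟩)
  have h₂ : superDerived K (zeroDiagPe K (Fin k)) = specialPe K (Fin k) :=
    le_antisymm (superDerived_le_specialPe le_rfl)
      (specialPe_le_superDerived hn specialPe_le_zeroDiagPe)
  have h₃ : superDerived K (specialPe K (Fin k)) = specialPe K (Fin k) :=
    le_antisymm (superDerived_le_specialPe specialPe_le_zeroDiagPe)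
      (specialPe_le_superDerived hn le_rfl)
  rw [h₁, h₂, h₃]
  refine ⟨?_, ?_, rfl⟩
  · ext X
    refine mem_zeroDiagPe.trans ⟨?_, ?_⟩
    · rintro ⟨A, C, hC, D, hD, rfl⟩
      exact ⟨A, C, D, hC.1, hC.2, hD.1, hD.2, rfl⟩
    · rintro ⟨A, C, D, hC, hC', hD, hD', rfl⟩
      exact ⟨A, C, ⟨hC, hC'⟩, D, ⟨hD, hD'⟩, rfl⟩
  · ext X
    refine mem_specialPe.trans ⟨?_, ?_⟩
    · rintro ⟨A, hA, C, hC, D, hD, rfl⟩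
      exact ⟨A, C, D, hC.1, hC.2, hD.1, hD.2, hA, rfl⟩
    · rintro ⟨A, C, D, hC, hC', hD, hD', hA, rfl⟩
      exact ⟨A, hA, C, ⟨hC, hC'⟩, D, ⟨hD, hD'⟩, rfl⟩
end

section
/- Let K be an algebraically closed field of characteristic 2 and k ≥ 1. Let B = [[0, A],[C, 0]] and B' = [[0, A'],[C', 0]] be 2k×2k matrices over K in block form with A, C, A', C' invertible k×k matrices (the Gram matrices of two non-degenerate odd bilinear forms on a superspace of dimension (k|k)). Then there exist invertible k×k matrices M₀, M₁ with B = diag(M₀, M₁) · B' · diag(M₀, M₁)ᵀ (i.e., B and B' are equivalent via an even invertible transformation) if and only if the matrices C(Aᵀ)⁻¹ and C'(A'ᵀ)⁻¹ are similar. -/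
open Matrix

/-- Classification of non-degenerate odd bilinear forms on a superspace of dimension `(k|k)`
over an algebraically closed field of characteristic 2: two forms with Gram matrices
`B = [[0,A],[C,0]]` and `B' = [[0,A'],[C',0]]` (with `A, C, A', C'` invertible) are equivalent
via an even invertible transformation `diag(M₀, M₁)` if and only if `C(Aᵀ)⁻¹` and `C'(A'ᵀ)⁻¹`
are similar matrices. -/
theorem odd_form_equivalent_iff_similar
    (K : Type*) [Field K] [IsAlgClosed K] [CharP K 2] (k : ℕ) (hk : 1 ≤ k)
    (A C A' C' : Matrix (Fin k) (Fin k) K)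
    (hA : IsUnit A.det) (hC : IsUnit C.det) (hA' : IsUnit A'.det) (hC' : IsUnit C'.det) :
    (∃ M₀ M₁ : Matrix (Fin k) (Fin k) K, IsUnit M₀.det ∧ IsUnit M₁.det ∧
        Matrix.fromBlocks 0 A C 0 =
          Matrix.fromBlocks M₀ 0 0 M₁ * Matrix.fromBlocks 0 A' C' 0 *
            (Matrix.fromBlocks M₀ 0 0 M₁)ᵀ) ↔
      (∃ P : Matrix (Fin k) (Fin k) K, IsUnit P.det ∧
        C * (Aᵀ)⁻¹ = P * (C' * (A'ᵀ)⁻¹) * P⁻¹) := by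
  have hAt : IsUnit (Aᵀ).det := by rwa [det_transpose]
  simp only [fromBlocks_transpose, fromBlocks_multiply, fromBlocks_inj, transpose_zero,
    Matrix.zero_mul, Matrix.mul_zero, add_zero, zero_add, true_and, and_true]
  constructor
  · rintro ⟨M₀, M₁, h₀, h₁, hAeq, hCeq⟩
    have h₀t : IsUnit (M₀ᵀ).det := by rwa [det_transpose]
    refine ⟨M₁, h₁, ?_⟩
    rw [hAeq, hCeq]
    simp only [transpose_mul, transpose_transpose, Matrix.mul_inv_rev, Matrix.mul_assoc]
    rw [mul_nonsing_inv_cancel_left _ _ h₀t]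
  · rintro ⟨P, hP, h⟩
    have hPt : IsUnit (Pᵀ).det := by rwa [det_transpose]
    refine ⟨A * (Pᵀ)⁻¹ * A'⁻¹, P, ?_, hP, ?_, ?_⟩
    · rw [det_mul, det_mul]
      exact (hA.mul (isUnit_nonsing_inv_det _ hPt)).mul (isUnit_nonsing_inv_det _ hA')
    · rw [nonsing_inv_mul_cancel_right _ _ hA', nonsing_inv_mul_cancel_right _ _ hPt]
    · calc C = C * (Aᵀ)⁻¹ * Aᵀ := (nonsing_inv_mul_cancel_right _ _ hAt).symm
        _ = P * C' * (A * (Pᵀ)⁻¹ * A'⁻¹)ᵀ := by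
          rw [h]
          simp only [transpose_mul, transpose_nonsing_inv, transpose_transpose, Matrix.mul_assoc]
end
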